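/- Let ω ∈ 𝒲 with associated function τ, let p ∈ (0,1), and let g ∈ L²_ω be such that the Hankel operator H_g extends to a bounded operator from A²_ω to L²_ω and belongs to the Schatten class S^p. Then there exists δ ∈ (0, m_τ) such that for every τ-covering {D(δτ(z_j))} of the unit disc 𝔻 one has ∑_j F_δ(z_j)^p < ∞. -/

import Mathlib

open MeasureTheory Filter Set
open scoped ENNReal ComplexOrder

noncomputable section

/-- The open unit disc in `ℂ`. -/
def unitDisc : Set ℂ := Metric.ball (0 : ℂ) 1

/-- Normalized area Lebesgue measure `dA = dx dy / π` on `ℂ`. -/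
def dA : Measure ℂ := (ENNReal.ofReal Real.pi)⁻¹ • (volume : Measure ℂ)

/-- The weighted measure `ω dA` on the unit disc. -/
def muW (ω : ℂ → ℝ) : Measure ℂ :=
  (dA.restrict unitDisc).withDensity fun z => ENNReal.ofReal (ω z)

/-- The radial extension to `𝔻` of a function of `r ∈ [0,1)`. -/
def radialize (τ : ℝ → ℝ) : ℂ → ℝ := fun z => τ ‖z‖

/-- The class `𝓛`, with constants `c₁, c₂`. -/
structure IsClassL (τC : ℂ → ℝ) (c₁ c₂ : ℝ) : Prop where
  c₁_pos : 0 < c₁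
  c₂_pos : 0 < c₂
  pos : ∀ z ∈ unitDisc, 0 < τC z
  upper : ∀ z ∈ unitDisc, τC z ≤ c₁ * (1 - ‖z‖)
  lip : ∀ z ∈ unitDisc, ∀ ζ ∈ unitDisc, |τC z - τC ζ| ≤ c₂ * ‖z - ζ‖

/-- `m_τ = min(1, c₁⁻¹, c₂⁻¹)/4`. -/
def mTau (c₁ c₂ : ℝ) : ℝ := min 1 (min c₁⁻¹ c₂⁻¹) / 4

/-- The Laplacian `Δφ = φ_xx + φ_yy` of a function `φ : ℂ → ℝ`. -/
def laplacian (φ : ℂ → ℝ) (z : ℂ) : ℝ :=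
  fderiv ℝ (fun w => fderiv ℝ φ w 1) z 1 +
    fderiv ℝ (fun w => fderiv ℝ φ w Complex.I) z Complex.I

/-- The Wirtinger derivative `∂̄g = (g_x + i g_y)/2` of `g : ℂ → ℂ`. -/
def dbar (g : ℂ → ℂ) (z : ℂ) : ℂ :=
  (fderiv ℝ g z 1 + Complex.I * fderiv ℝ g z Complex.I) / 2

/-- The class `𝒲` of weights `ω = e^{-2φ}` with associated radial profile `τ`. -/
structure IsClassW (ω φ : ℂ → ℝ) (τ : ℝ → ℝ) : Prop where
  pos : ∀ z ∈ unitDisc, 0 < ω z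
  omega_eq : ∀ z ∈ unitDisc, ω z = Real.exp (-(2 * φ z))
  integrable : ∫⁻ z in unitDisc, ENNReal.ofReal (ω z) ∂dA < ⊤
  radial : ∀ z ∈ unitDisc, ∀ ζ ∈ unitDisc, ‖z‖ = ‖ζ‖ → φ z = φ ζ
  smooth : ContDiffOn ℝ 2 φ unitDisc
  lap_pos : ∀ z ∈ unitDisc, 0 < laplacian φ z
  tau_pos : ∀ r ∈ Set.Ico (0 : ℝ) 1, 0 < τ r
  tau_anti : AntitoneOn τ (Set.Ico 0 1)
  tau_lim : Tendsto τ (nhdsWithin 1 (Set.Iio 1)) (nhds 0)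
  tau_diff : ∀ r ∈ Set.Ico (0 : ℝ) 1, DifferentiableAt ℝ τ r
  tau_deriv_lim : Tendsto (deriv τ) (nhdsWithin 1 (Set.Iio 1)) (nhds 0)
  comp : ∃ C : ℝ, 1 ≤ C ∧ ∀ z ∈ unitDisc,
    τ ‖z‖ / C ≤ (laplacian φ z) ^ (-(1 / 2 : ℝ)) ∧
      (laplacian φ z) ^ (-(1 / 2 : ℝ)) ≤ C * τ ‖z‖
  extra : (∃ C > (0 : ℝ), ∃ r₀ ∈ Set.Ico (0 : ℝ) 1,
      MonotoneOn (fun r => τ r * (1 - r) ^ C) (Set.Ico r₀ 1)) ∨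
    Tendsto (fun r => deriv τ r * Real.log (1 / τ r)) (nhdsWithin 1 (Set.Iio 1)) (nhds 0)

/-- A `(δ,τ)`-lattice of the unit disc. -/
structure IsLattice (τC : ℂ → ℝ) (δ : ℝ) (z : ℕ → ℂ) : Prop where
  mem : ∀ j, z j ∈ unitDisc
  sep : ∀ j k, j ≠ k → z j ∉ Metric.ball (z k) (δ * τC (z k))
  covers : ∀ w ∈ unitDisc, ∃ j, w ∈ Metric.ball (z j) (δ * τC (z j))
  mult : ∃ N : ℕ, ∀ w ∈ unitDisc,
    ({j : ℕ | w ∈ Metric.ball (z j) (3 * (δ * τC (z j)))}).ncard ≤ N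

/-- The distance `d_τ(z,ζ) = |z-ζ| / min(τ(z),τ(ζ))`. -/
def dTau (τC : ℂ → ℝ) (z ζ : ℂ) : ℝ := ‖z - ζ‖ / min (τC z) (τC ζ)

/-- `(1/|D(δτ(z))|) ∫_{D(δτ(z))} |u|² dA`, valued in `ℝ≥0∞`. -/
def localMeanE (τC : ℂ → ℝ) (δ : ℝ) (u : ℂ → ℂ) (z : ℂ) : ℝ≥0∞ :=
  (ENNReal.ofReal ((δ * τC z) ^ 2))⁻¹ *
    ∫⁻ w in Metric.ball z (δ * τC z), ENNReal.ofReal (‖u w‖ ^ 2) ∂dA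

/-- `F_δ(z)² = inf over h analytic in D(δτ(z)) of the mean square of g - h`. -/
def FdeltaSqE (τC : ℂ → ℝ) (δ : ℝ) (g : ℂ → ℂ) (z : ℂ) : ℝ≥0∞ :=
  ⨅ (h : ℂ → ℂ) (_ : DifferentiableOn ℂ h (Metric.ball z (δ * τC z))),
    localMeanE τC δ (fun w => g w - h w) z

/-- The submodule of `L²_ω` of elements with a representative analytic on `𝔻`. -/
def bergmanSubmodule (ω : ℂ → ℝ) : Submodule ℂ (Lp ℂ 2 (muW ω)) where
  carrier := {f | ∃ F : ℂ → ℂ, DifferentiableOn ℂ F unitDisc ∧ (f : ℂ → ℂ) =ᵐ[muW ω] F}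
  zero_mem' := ⟨0, differentiableOn_const 0, Lp.coeFn_zero ℂ 2 (muW ω)⟩
  add_mem' := by
    rintro a b ⟨F, hF, ha⟩ ⟨G, hG, hb⟩
    refine ⟨F + G, hF.add hG, ?_⟩
    filter_upwards [Lp.coeFn_add a b, ha, hb] with w h1 h2 h3
    rw [h1]; simp only [Pi.add_apply, h2, h3]
  smul_mem' := by
    rintro c a ⟨F, hF, ha⟩
    refine ⟨c • F, hF.const_smul c, ?_⟩
    filter_upwards [Lp.coeFn_smul c a, ha] with w h1 h2
    rw [h1]; simp only [Pi.smul_apply, h2]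

/-- The Bergman space `A²_ω`, a closed subspace of `L²_ω`. -/
def bergmanH (ω : ℂ → ℝ) : Submodule ℂ (Lp ℂ 2 (muW ω)) :=
  (bergmanSubmodule ω).topologicalClosure

instance (ω : ℂ → ℝ) : CompleteSpace (bergmanH ω) :=
  completeSpace_coe_iff_isComplete.2 (Submodule.isClosed_topologicalClosure _).isComplete

/-- The orthogonal (Bergman) projection of `L²_ω` onto `A²_ω`, valued in `A²_ω`. -/
def bergmanProjA (ω : ℂ → ℝ) : Lp ℂ 2 (muW ω) →L[ℂ] bergmanH ω :=
  Submodule.orthogonalProjectionOnto (bergmanH ω)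

/-- The Bergman projection `P`, viewed as an operator of `L²_ω`. -/
def bergmanProj (ω : ℂ → ℝ) : Lp ℂ 2 (muW ω) →L[ℂ] Lp ℂ 2 (muW ω) :=
  (bergmanH ω).subtypeL.comp (bergmanProjA ω)

/-- `T` is a bounded extension of the Hankel operator `H_g : f ↦ g f - P(g f)`,
defined on the bounded analytic functions `f ∈ H^∞`. -/
def IsHankelExtension (ω : ℂ → ℝ) (g : ℂ → ℂ)
    (T : bergmanH ω →L[ℂ] Lp ℂ 2 (muW ω)) : Prop :=
  ∀ (f : bergmanH ω) (F : ℂ → ℂ) (M : ℝ),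
    DifferentiableOn ℂ F unitDisc →
    (∀ z ∈ unitDisc, ‖F z‖ ≤ M) →
    ((f : Lp ℂ 2 (muW ω)) : ℂ → ℂ) =ᵐ[muW ω] F →
    ∀ gF : Lp ℂ 2 (muW ω), ((gF : ℂ → ℂ) =ᵐ[muW ω] fun z => g z * F z) →
    T f = gF - bergmanProj ω gF

/-- The `ν`-th singular number `s_ν(T) = inf{‖T - K‖ : rank K ≤ ν}`, `ν = 0, 1, 2, …`. -/
def singularNumber {E F : Type*} [NormedAddCommGroup E] [NormedSpace ℂ E]
    [NormedAddCommGroup F] [NormedSpace ℂ F] (T : E →L[ℂ] F) (ν : ℕ) : ℝ :=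
  sInf {c : ℝ | ∃ K : E →L[ℂ] F,
    Module.rank ℂ (LinearMap.range (K : E →ₗ[ℂ] F)) ≤ (ν : Cardinal) ∧ c = ‖T - K‖}

/-- `‖T‖_{S^p}^p = ∑_ν s_ν(T)^p`. -/
def schattenSum (p : ℝ) {E F : Type*} [NormedAddCommGroup E] [NormedSpace ℂ E]
    [NormedAddCommGroup F] [NormedSpace ℂ F] (T : E →L[ℂ] F) : ℝ :=
  ∑' ν : ℕ, singularNumber T ν ^ p

/-- Membership in the Schatten class `S^p`: `∑_ν s_ν(T)^p < ∞`. -/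
def MemSchatten (p : ℝ) {E F : Type*} [NormedAddCommGroup E] [NormedSpace ℂ E]
    [NormedAddCommGroup F] [NormedSpace ℂ F] (T : E →L[ℂ] F) : Prop :=
  Summable fun ν : ℕ => singularNumber T ν ^ p

/-- A bounded operator has finite rank. -/
def FiniteRank {E F : Type*} [NormedAddCommGroup E] [NormedSpace ℂ E]
    [NormedAddCommGroup F] [NormedSpace ℂ F] (T : E →L[ℂ] F) : Prop :=
  Module.rank ℂ (LinearMap.range (T : E →ₗ[ℂ] F)) < Cardinal.aleph0

/-- The decay estimate `|F(z)| ω(z)^{1/2} ≲ min(1, min(τ(α),τ(z))/|z-α|)^{3n}` on `𝔻`. -/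
def TestDecay (τC ω : ℂ → ℝ) (C₀ : ℝ) (n : ℕ) (α : ℂ) (F : ℂ → ℂ) : Prop :=
  (∀ z ∈ unitDisc, ‖F z‖ * Real.sqrt (ω z) ≤ C₀) ∧
    ∀ z ∈ unitDisc, z ≠ α → ‖F z‖ * Real.sqrt (ω z) ≤
      C₀ * (min (τC α) (τC z) / ‖z - α‖) ^ (3 * n)

/-- Multiplication of an `L²_ω` element by the indicator of a measurable set `D`. -/
def indLp (ω : ℂ → ℝ) (D : Set ℂ) (hD : MeasurableSet D) (f : Lp ℂ 2 (muW ω)) :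
    Lp ℂ 2 (muW ω) :=
  MemLp.toLp (D.indicator f) ((Lp.memLp f).indicator hD)

/-- The subspace of `L²_ω` of elements vanishing a.e. off `D` with a representative
analytic on `D`;  its closure realizes `A²_ω(D)` inside `L²_ω`. -/
def localBergmanSub (ω : ℂ → ℝ) (D : Set ℂ) : Submodule ℂ (Lp ℂ 2 (muW ω)) where
  carrier := {f | ((f : ℂ → ℂ) =ᵐ[(muW ω).restrict Dᶜ] 0) ∧
    ∃ h : ℂ → ℂ, DifferentiableOn ℂ h D ∧ (f : ℂ → ℂ) =ᵐ[(muW ω).restrict D] h}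
  zero_mem' := by
    refine ⟨ae_restrict_of_ae (Lp.coeFn_zero ℂ 2 (muW ω)), 0, differentiableOn_const 0,
      ae_restrict_of_ae (Lp.coeFn_zero ℂ 2 (muW ω))⟩
  add_mem' := by
    rintro a b ⟨ha0, F, hF, ha⟩ ⟨hb0, G, hG, hb⟩
    refine ⟨?_, F + G, hF.add hG, ?_⟩
    · filter_upwards [ae_restrict_of_ae (Lp.coeFn_add a b), ha0, hb0] with w h1 h2 h3
      rw [h1]; simp only [Pi.add_apply, h2, h3, Pi.zero_apply, add_zero]
    · filter_upwards [ae_restrict_of_ae (Lp.coeFn_add a b), ha, hb] with w h1 h2 h3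
      rw [h1]; simp only [Pi.add_apply, h2, h3]
  smul_mem' := by
    rintro c a ⟨ha0, F, hF, ha⟩
    refine ⟨?_, c • F, hF.const_smul c, ?_⟩
    · filter_upwards [ae_restrict_of_ae (Lp.coeFn_smul c a), ha0] with w h1 h2
      rw [h1]; simp only [Pi.smul_apply, h2, Pi.zero_apply, smul_zero]
    · filter_upwards [ae_restrict_of_ae (Lp.coeFn_smul c a), ha] with w h1 h2
      rw [h1]; simp only [Pi.smul_apply, h2]

instance (ω : ℂ → ℝ) (D : Set ℂ) :
    CompleteSpace ((localBergmanSub ω D).topologicalClosure) :=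
  completeSpace_coe_iff_isComplete.2 (Submodule.isClosed_topologicalClosure _).isComplete

/-- The local projection `P_{α,δ}` (for `D = D(δτ(α))`), extended by zero off `D`,
viewed as an operator of `L²_ω`. -/
def localProj (ω : ℂ → ℝ) (D : Set ℂ) : Lp ℂ 2 (muW ω) →L[ℂ] Lp ℂ 2 (muW ω) :=
  ((localBergmanSub ω D).topologicalClosure).subtypeL.comp
    (Submodule.orthogonalProjectionOnto ((localBergmanSub ω D).topologicalClosure))



/-- The integral `∫ (1+|x|)^{-3}` over the plane. -/
def hkI : ℝ := ∫ x : ℂ, (1 / (1 + ‖x‖) ^ 3 : ℝ)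

lemma hk_integrable0 : Integrable (fun x : ℂ => (1 / (1 + ‖x‖) ^ 3 : ℝ)) := by
  have h := integrable_one_add_norm (E := ℂ) (μ := volume) (r := 3)
    (by rw [Complex.finrank_real_complex]; norm_num)
  refine h.congr (Eventually.of_forall fun x => ?_)
  have : (0 : ℝ) < 1 + ‖x‖ := by positivity
  simp only
  rw [Real.rpow_neg this.le, one_div]
  congr 1
  exact_mod_cast Real.rpow_natCast (1 + ‖x‖) 3

lemma hkI_nonneg : 0 ≤ hkI := integral_nonneg fun x => by positivity

lemma hk_kern_eq (w : ℂ) (s : ℝ) (hs : 0 < s) :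
    (fun x : ℂ => (1 / (1 + ‖x - w‖ / s) ^ 3 : ℝ)) =
      fun x => (fun y : ℂ => (fun v : ℂ => (1 / (1 + ‖v‖) ^ 3 : ℝ)) (s⁻¹ • y)) (x - w) := by
  funext x
  simp only [norm_smul, norm_inv, Real.norm_eq_abs, abs_of_pos hs]
  rw [div_eq_inv_mul ‖x - w‖ s]

lemma hk_kern_integrable (w : ℂ) (s : ℝ) (hs : 0 < s) :
    Integrable (fun x : ℂ => (1 / (1 + ‖x - w‖ / s) ^ 3 : ℝ)) := by
  rw [hk_kern_eq w s hs]
  exact ((integrable_comp_smul_iff volume _ (inv_ne_zero hs.ne')).2 hk_integrable0).comp_sub_right w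

lemma hk_kern_integral (w : ℂ) (s : ℝ) (hs : 0 < s) :
    ∫ x : ℂ, (1 / (1 + ‖x - w‖ / s) ^ 3 : ℝ) = s ^ 2 * hkI := by
  rw [hk_kern_eq w s hs]
  rw [integral_sub_right_eq_self (fun y : ℂ => (fun v : ℂ => (1 / (1 + ‖v‖) ^ 3 : ℝ)) (s⁻¹ • y)) w]
  rw [Measure.integral_comp_inv_smul volume (fun v : ℂ => (1 / (1 + ‖v‖) ^ 3 : ℝ)) s,
    Complex.finrank_real_complex]
  simp [hkI]

lemma hk_vol_ball (a : ℂ) (r : ℝ) (hr : 0 ≤ r) :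
    (volume : Measure ℂ).real (Metric.ball a r) = Real.pi * r ^ 2 := by
  rw [Measure.real, Complex.volume_ball]
  simp [ENNReal.toReal_ofReal hr, mul_comm]

lemma hk_geo {t : ℂ → ℝ} {c₁ c₂ : ℝ} (hL : IsClassL t c₁ c₂) {δ : ℝ} (hδ : 0 < δ)
    (hδ1 : δ ≤ 1 / 4) (hδ2 : δ * c₂ ≤ 1 / 4) (z : ℕ → ℂ) (hz : ∀ j, z j ∈ unitDisc)
    (hsep : ∀ j k, j ≠ k → δ * t (z k) ≤ ‖z j - z k‖) (S : Finset ℕ) (w : ℂ)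
    (hw : w ∈ unitDisc) :
    ∑ k ∈ S, t (z k) ^ 2 * (1 / (1 + ‖z k - w‖ / t w) ^ 3) ≤
      (32 * hkI / (Real.pi * δ ^ 2)) * t w ^ 2 := by
  have htw := hL.pos w hw
  set B : ℕ → Set ℂ := fun k => Metric.ball (z k) (δ * t (z k) / 2) with hB
  have hdisj : (S : Set ℕ).PairwiseDisjoint B := by
    intro i _ j _ hij
    refine Metric.ball_disjoint_ball ?_
    have h1 := hsep i j hij
    have h2 := hsep j i hij.symm
    rw [norm_sub_rev] at h2
    rw [dist_eq_norm]; linarith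
  have hIntg := hk_kern_integrable w (t w) htw
  have key : ∀ k ∈ S, Real.pi * δ ^ 2 / 32 * (t (z k) ^ 2 * (1 / (1 + ‖z k - w‖ / t w) ^ 3)) ≤
      ∫ x in B k, (1 / (1 + ‖x - w‖ / t w) ^ 3 : ℝ) := by
    intro k _
    have htk := hL.pos (z k) (hz k)
    have hlow : ∀ x ∈ B k, (1 / 8 * (1 / (1 + ‖z k - w‖ / t w) ^ 3) : ℝ) ≤
        1 / (1 + ‖x - w‖ / t w) ^ 3 := by
      intro x hx
      have hx' : ‖x - z k‖ < δ * t (z k) / 2 := by simpa [hB, dist_eq_norm] using hx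
      have hlip := hL.lip (z k) (hz k) w hw
      have hl2 : t (z k) ≤ t w + c₂ * ‖z k - w‖ := by linarith [le_abs_self (t (z k) - t w)]
      have htri : ‖x - w‖ ≤ ‖x - z k‖ + ‖z k - w‖ := norm_sub_le_norm_sub_add_norm_sub _ _ _
      have h4 : δ * t (z k) ≤ t w / 4 + ‖z k - w‖ / 4 := by
        have h5 := mul_le_mul_of_nonneg_left hl2 hδ.le
        have h6 := mul_le_mul_of_nonneg_right hδ1 htw.le
        have h7 := mul_le_mul_of_nonneg_right hδ2 (norm_nonneg (z k - w))
        nlinarith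
      have h8 : ‖x - w‖ / t w ≤ 1 + 2 * (‖z k - w‖ / t w) := by
        rw [div_le_iff₀ htw, add_mul, mul_assoc, div_mul_cancel₀ _ htw.ne']
        linarith [norm_nonneg (z k - w)]
      have hp : 0 ≤ ‖z k - w‖ / t w := by positivity
      have h9 : 1 + ‖x - w‖ / t w ≤ 2 * (1 + ‖z k - w‖ / t w) := by linarith
      have h10 : (1 + ‖x - w‖ / t w) ^ 3 ≤ (2 * (1 + ‖z k - w‖ / t w)) ^ 3 := by gcongr
      rw [show (1 / 8 * (1 / (1 + ‖z k - w‖ / t w) ^ 3) : ℝ) =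
        1 / (2 * (1 + ‖z k - w‖ / t w)) ^ 3 by rw [mul_pow]; field_simp; norm_num]
      exact one_div_le_one_div_of_le (by positivity) h10
    have h1 : ∫ x in B k, (1 / 8 * (1 / (1 + ‖z k - w‖ / t w) ^ 3) : ℝ) ≤
        ∫ x in B k, (1 / (1 + ‖x - w‖ / t w) ^ 3 : ℝ) := by
      refine setIntegral_mono_on ?_ hIntg.integrableOn Metric.isOpen_ball.measurableSet hlow
      exact integrableOn_const (by
        simp only [hB]; exact measure_ball_lt_top.ne)
    rw [setIntegral_const, smul_eq_mul, hB, hk_vol_ball _ _ (by positivity)] at h1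
    refine le_trans (le_of_eq ?_) h1
    ring
  have hsum : Real.pi * δ ^ 2 / 32 *
      ∑ k ∈ S, t (z k) ^ 2 * (1 / (1 + ‖z k - w‖ / t w) ^ 3) ≤ t w ^ 2 * hkI := by
    rw [Finset.mul_sum]
    refine (Finset.sum_le_sum key).trans ?_
    rw [← integral_biUnion_finset S (fun k _ => Metric.isOpen_ball.measurableSet) hdisj
      (fun k _ => hIntg.integrableOn), ← hk_kern_integral w (t w) htw]
    exact setIntegral_le_integral hIntg (Eventually.of_forall fun x => by
      simp only [Pi.zero_apply]; positivity)
  have hpi := Real.pi_pos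
  rw [div_mul_eq_mul_div, le_div_iff₀ (by positivity)]
  nlinarith [hsum]

/-- The model decay function of the test functions. -/
def hkE (t : ℂ → ℝ) (α z : ℂ) : ℝ := min (t z) (t α) / t α * (1 / (1 + ‖z - α‖ / t α) ^ 4)

lemma hkE_nonneg {t : ℂ → ℝ} {α z : ℂ} (h1 : 0 < t α) (h2 : 0 < t z) : 0 ≤ hkE t α z := by
  have : 0 ≤ min (t z) (t α) := le_min h2.le h1.le
  unfold hkE; positivity

lemma hkE_le_kern {t : ℂ → ℝ} {α z : ℂ} (h1 : 0 < t α) :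
    hkE t α z ≤ 1 / (1 + ‖z - α‖ / t α) ^ 3 := by
  unfold hkE
  have h3 : min (t z) (t α) / t α ≤ 1 := (div_le_one h1).2 (min_le_right _ _)
  have h4 : (1 / (1 + ‖z - α‖ / t α) ^ 4 : ℝ) ≤ 1 / (1 + ‖z - α‖ / t α) ^ 3 := by
    refine one_div_le_one_div_of_le (by positivity) ?_
    exact pow_le_pow_right₀ (by simp; positivity) (by norm_num)
  calc _ ≤ 1 * (1 / (1 + ‖z - α‖ / t α) ^ 4 : ℝ) := by gcongr
    _ ≤ _ := by rw [one_mul]; exact h4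

lemma hkE_row_pt {t : ℂ → ℝ} {c₁ c₂ : ℝ} (hL : IsClassL t c₁ c₂) {α z : ℂ}
    (hα : α ∈ unitDisc) (hz : z ∈ unitDisc) :
    hkE t α z ≤ (1 + c₂) ^ 3 / t z ^ 2 * (t α ^ 2 * (1 / (1 + ‖α - z‖ / t z) ^ 3)) := by
  have hA := hL.pos α hα
  have hZ := hL.pos z hz
  have hc := hL.c₂_pos
  have hlip := hL.lip z hz α hα
  have hl : t z ≤ t α + c₂ * ‖z - α‖ := by linarith [le_abs_self (t z - t α)]
  unfold hkE
  rw [norm_sub_rev α z]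
  set A := t α
  set Z := t z
  set d := ‖z - α‖ with hd
  have hd0 : 0 ≤ d := norm_nonneg _
  have e1 : (1 + d / A) = (A + d) / A := by field_simp
  have e2 : (1 + d / Z) = (Z + d) / Z := by field_simp
  have h1 : (Z + d) ^ 3 ≤ ((1 + c₂) * (A + d)) ^ 3 := by
    have : Z + d ≤ (1 + c₂) * (A + d) := by nlinarith [mul_pos hc hA]
    gcongr
  calc min Z A / A * (1 / (1 + d / A) ^ 4) ≤ Z / A * (1 / (1 + d / A) ^ 4) := by
        gcongr; exact min_le_left _ _
    _ = Z * A ^ 3 / (A + d) ^ 4 := by rw [e1]; field_simp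
    _ ≤ (1 + c₂) ^ 3 * (A ^ 2 * Z) / (Z + d) ^ 3 := by
        rw [div_le_div_iff₀ (by positivity) (by positivity)]
        calc Z * A ^ 3 * (Z + d) ^ 3 ≤ Z * A ^ 3 * ((1 + c₂) * (A + d)) ^ 3 := by gcongr
          _ = (1 + c₂) ^ 3 * (A ^ 2 * Z) * ((A + d) ^ 3 * A) := by ring
          _ ≤ (1 + c₂) ^ 3 * (A ^ 2 * Z) * ((A + d) ^ 3 * (A + d)) := by gcongr; linarith
          _ = _ := by ring
    _ = _ := by rw [e2]; field_simp

lemma hkE_row {t : ℂ → ℝ} {c₁ c₂ : ℝ} (hL : IsClassL t c₁ c₂) {δ : ℝ} (hδ : 0 < δ)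
    (hδ1 : δ ≤ 1 / 4) (hδ2 : δ * c₂ ≤ 1 / 4) (z : ℕ → ℂ) (hz : ∀ j, z j ∈ unitDisc)
    (hsep : ∀ j k, j ≠ k → δ * t (z k) ≤ ‖z j - z k‖) (S : Finset ℕ) (w : ℂ)
    (hw : w ∈ unitDisc) :
    ∑ k ∈ S, hkE t (z k) w ≤ (1 + c₂) ^ 3 * (32 * hkI / (Real.pi * δ ^ 2)) := by
  have htw := hL.pos w hw
  have hc := hL.c₂_pos
  calc ∑ k ∈ S, hkE t (z k) w ≤ ∑ k ∈ S, (1 + c₂) ^ 3 / t w ^ 2 *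
        (t (z k) ^ 2 * (1 / (1 + ‖z k - w‖ / t w) ^ 3)) :=
        Finset.sum_le_sum fun k _ => hkE_row_pt hL (hz k) hw
    _ = (1 + c₂) ^ 3 / t w ^ 2 * ∑ k ∈ S, (t (z k) ^ 2 * (1 / (1 + ‖z k - w‖ / t w) ^ 3)) := by
        rw [Finset.mul_sum]
    _ ≤ (1 + c₂) ^ 3 / t w ^ 2 * ((32 * hkI / (Real.pi * δ ^ 2)) * t w ^ 2) := by
        gcongr; exact hk_geo hL hδ hδ1 hδ2 z hz hsep S w hw
    _ = _ := by field_simp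

lemma hkE_col {t : ℂ → ℝ} {c₁ c₂ : ℝ} (hL : IsClassL t c₁ c₂) {δ : ℝ} (hδ : 0 < δ)
    (hδ1 : δ ≤ 1 / 4) (hδ2 : δ * c₂ ≤ 1 / 4) (z : ℕ → ℂ) (hz : ∀ j, z j ∈ unitDisc)
    (hsep : ∀ j k, j ≠ k → δ * t (z k) ≤ ‖z j - z k‖) (S : Finset ℕ) (k : ℕ) (R : ℝ) (hR : 0 < R)
    (hRsep : ∀ j ∈ S, j ≠ k → R * min (t (z j)) (t (z k)) ≤ ‖z j - z k‖) :
    ∑ j ∈ S.erase k, t (z j) ^ 2 * hkE t (z k) (z j) ≤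
      (32 * hkI / (Real.pi * δ ^ 2)) / R * t (z k) ^ 2 := by
  have htk := hL.pos (z k) (hz k)
  calc ∑ j ∈ S.erase k, t (z j) ^ 2 * hkE t (z k) (z j) ≤
        ∑ j ∈ S.erase k, 1 / R * (t (z j) ^ 2 * (1 / (1 + ‖z j - z k‖ / t (z k)) ^ 3)) := by
        refine Finset.sum_le_sum fun j hj => ?_
        have h := hRsep j (Finset.mem_of_mem_erase hj) (Finset.ne_of_mem_erase hj)
        unfold hkE
        have hx : 0 ≤ ‖z j - z k‖ / t (z k) := by positivity
        have h1 : min (t (z j)) (t (z k)) / t (z k) ≤ 1 / R * (1 + ‖z j - z k‖ / t (z k)) := by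
          have : min (t (z j)) (t (z k)) / t (z k) ≤ 1 / R * (‖z j - z k‖ / t (z k)) := by
            rw [← mul_div_assoc]
            gcongr
            rw [one_div, inv_mul_eq_div, le_div_iff₀ hR]; linarith
          refine this.trans ?_
          gcongr; linarith
        calc _ ≤ t (z j) ^ 2 * (1 / R * (1 + ‖z j - z k‖ / t (z k)) *
              (1 / (1 + ‖z j - z k‖ / t (z k)) ^ 4)) := by gcongr
          _ = _ := by
            have : (1 + ‖z j - z k‖ / t (z k)) ≠ 0 := by positivity
            field_simp
    _ = 1 / R * ∑ j ∈ S.erase k, (t (z j) ^ 2 * (1 / (1 + ‖z j - z k‖ / t (z k)) ^ 3)) := by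
        rw [Finset.mul_sum]
    _ ≤ 1 / R * ((32 * hkI / (Real.pi * δ ^ 2)) * t (z k) ^ 2) := by
        gcongr; exact hk_geo hL hδ hδ1 hδ2 z hz hsep _ _ (hz k)
    _ = _ := by ring

lemma hkE_stab {t : ℂ → ℝ} {c₁ c₂ : ℝ} (hL : IsClassL t c₁ c₂) {δ : ℝ} (hδ : 0 < δ)
    (hδ1 : δ ≤ 1 / 4) (hδ2 : δ * c₂ ≤ 1 / 4) {α ζ w : ℂ}
    (hα : α ∈ unitDisc) (hζ : ζ ∈ unitDisc) (hw : w ∈ unitDisc) (hwζ : ‖w - ζ‖ < δ * t ζ) :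
    hkE t α w ≤ 32 * hkE t α ζ := by
  have hA := hL.pos α hα
  have hZ := hL.pos ζ hζ
  have hW := hL.pos w hw
  have hc := hL.c₂_pos
  have hl1 : t w ≤ 2 * t ζ := by
    have := hL.lip w hw ζ hζ
    have h2 : c₂ * ‖w - ζ‖ ≤ c₂ * (δ * t ζ) := by gcongr
    have h3 := mul_le_mul_of_nonneg_right hδ2 hZ.le
    nlinarith [le_abs_self (t w - t ζ)]
  have hl2 : δ * t ζ ≤ t α / 4 + ‖ζ - α‖ / 4 := by
    have h1 : t ζ ≤ t α + c₂ * ‖ζ - α‖ := by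
      linarith [hL.lip ζ hζ α hα, le_abs_self (t ζ - t α)]
    have h5 := mul_le_mul_of_nonneg_left h1 hδ.le
    have h6 := mul_le_mul_of_nonneg_right hδ1 hA.le
    have h7 := mul_le_mul_of_nonneg_right hδ2 (norm_nonneg (ζ - α))
    nlinarith
  have htri : ‖ζ - α‖ ≤ ‖w - α‖ + ‖w - ζ‖ := by
    rw [norm_sub_rev w ζ, add_comm]; exact norm_sub_le_norm_sub_add_norm_sub _ _ _
  have h1 : 1 + ‖ζ - α‖ / t α ≤ 2 * (1 + ‖w - α‖ / t α) := by
    have : ‖ζ - α‖ / t α ≤ 1 + 2 * (‖w - α‖ / t α) := by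
      rw [div_le_iff₀ hA, add_mul, mul_assoc, div_mul_cancel₀ _ hA.ne']
      linarith [norm_nonneg (w - α)]
    linarith
  have hmin : min (t w) (t α) ≤ 2 * min (t ζ) (t α) := by
    rcases le_total (t ζ) (t α) with h | h
    · rw [min_eq_left h]; exact (min_le_left _ _).trans hl1
    · rw [min_eq_right h]; exact (min_le_right _ _).trans (by linarith)
  unfold hkE
  have h4 : (1 / (1 + ‖w - α‖ / t α) ^ 4 : ℝ) ≤ 16 * (1 / (1 + ‖ζ - α‖ / t α) ^ 4) := by
    rw [mul_one_div, div_le_div_iff₀ (by positivity) (by positivity), one_mul]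
    calc _ ≤ (2 * (1 + ‖w - α‖ / t α)) ^ 4 := by gcongr
      _ = _ := by ring
  have hm0 : 0 ≤ min (t ζ) (t α) := le_min hZ.le hA.le
  calc _ ≤ (2 * min (t ζ) (t α)) / t α * (16 * (1 / (1 + ‖ζ - α‖ / t α) ^ 4)) := by gcongr
    _ = _ := by ring

lemma hk_count {t : ℂ → ℝ} {c₁ c₂ : ℝ} (hL : IsClassL t c₁ c₂) {δ : ℝ} (hδ : 0 < δ)
    (hδ1 : δ ≤ 1 / 4) (hδ2 : δ * c₂ ≤ 1 / 4) (z : ℕ → ℂ) (hz : ∀ j, z j ∈ unitDisc)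
    (hsep : ∀ j k, j ≠ k → δ * t (z k) ≤ ‖z j - z k‖) (S : Finset ℕ) (w : ℂ)
    (hw : w ∈ unitDisc) (R : ℝ) (hR : 0 < R)
    (hS : ∀ k ∈ S, ‖z k - w‖ ≤ R * min (t (z k)) (t w)) :
    (S.card : ℝ) ≤ (32 * hkI / (Real.pi * δ ^ 2)) * ((1 + R) ^ 3 * (1 + c₂ * R) ^ 2) := by
  have htw := hL.pos w hw
  have hc := hL.c₂_pos
  have h := hk_geo hL hδ hδ1 hδ2 z hz hsep S w hw
  have h2 : ∀ k ∈ S, t w ^ 2 / ((1 + R) ^ 3 * (1 + c₂ * R) ^ 2) ≤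
      t (z k) ^ 2 * (1 / (1 + ‖z k - w‖ / t w) ^ 3) := by
    intro k hk
    have htk := hL.pos (z k) (hz k)
    have h3 := hS k hk
    have h4 : ‖z k - w‖ ≤ R * t (z k) := h3.trans (by gcongr; exact min_le_left _ _)
    have h5 : ‖z k - w‖ / t w ≤ R := by
      rw [div_le_iff₀ htw]; exact h3.trans (by gcongr; exact min_le_right _ _)
    have h6 : t w ≤ (1 + c₂ * R) * t (z k) := by
      have := hL.lip (z k) (hz k) w hw
      have h7 : c₂ * ‖z k - w‖ ≤ c₂ * (R * t (z k)) := by gcongr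
      nlinarith [neg_abs_le (t (z k) - t w)]
    have h8 : (1 / (1 + R) ^ 3 : ℝ) ≤ 1 / (1 + ‖z k - w‖ / t w) ^ 3 := by gcongr
    calc t w ^ 2 / ((1 + R) ^ 3 * (1 + c₂ * R) ^ 2)
        ≤ ((1 + c₂ * R) * t (z k)) ^ 2 / ((1 + R) ^ 3 * (1 + c₂ * R) ^ 2) := by gcongr
      _ = t (z k) ^ 2 * (1 / (1 + R) ^ 3) := by field_simp
      _ ≤ _ := by gcongr
  have h3 := Finset.card_nsmul_le_sum S _ _ h2
  rw [nsmul_eq_mul] at h3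
  have h4 := h3.trans h
  have hpos : 0 < t w ^ 2 := by positivity
  rw [← mul_div_assoc, div_le_iff₀ (by positivity)] at h4
  refine le_of_mul_le_mul_right ?_ hpos
  linarith

lemma hk_disc_sub {t : ℂ → ℝ} {c₁ c₂ : ℝ} (hL : IsClassL t c₁ c₂) {δ : ℝ}
    (hδc : δ * c₁ ≤ 1 / 4) {α w : ℂ} (hα : α ∈ unitDisc)
    (hw : ‖w - α‖ < δ * t α) (hδ : 0 < δ) : w ∈ unitDisc := by
  have h1 := hL.upper α hα
  have hα' : ‖α‖ < 1 := by simpa [unitDisc] using hα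
  have h2 : δ * t α ≤ δ * (c₁ * (1 - ‖α‖)) := by gcongr
  have h3 : ‖w‖ ≤ ‖w - α‖ + ‖α‖ := by simpa using norm_add_le (w - α) α
  have : ‖w‖ < 1 := by nlinarith
  simpa [unitDisc] using this

lemma hk_disj {t : ℂ → ℝ} {c₁ c₂ : ℝ} (hL : IsClassL t c₁ c₂) {δ : ℝ} (hδ : 0 < δ)
    (hδ1 : δ ≤ 1 / 4) (hδ2 : δ * c₂ ≤ 1 / 4) {a b : ℂ} (ha : a ∈ unitDisc) (hb : b ∈ unitDisc)
    {R : ℝ} (hR : 1 ≤ R) (h : R * min (t a) (t b) ≤ ‖a - b‖) :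
    Disjoint (Metric.ball a (δ * t a)) (Metric.ball b (δ * t b)) := by
  refine Metric.ball_disjoint_ball ?_
  rw [dist_eq_norm]
  by_contra hcon
  push Not at hcon
  have hA := hL.pos a ha
  have hB := hL.pos b hb
  have hl := hL.lip a ha b hb
  have hc := hL.c₂_pos
  have h1 : c₂ * ‖a - b‖ ≤ c₂ * (δ * t a + δ * t b) := by gcongr
  have h2 := mul_le_mul_of_nonneg_right hδ2 hA.le
  have h3 := mul_le_mul_of_nonneg_right hδ2 hB.le
  have h4 := mul_le_mul_of_nonneg_right hδ1 hA.le
  have h5 := mul_le_mul_of_nonneg_right hδ1 hB.le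
  obtain ⟨l1, l2⟩ := abs_le.1 (hl.trans h1)
  have hm : 0 < min (t a) (t b) := lt_min hA hB
  have h6 : min (t a) (t b) ≤ ‖a - b‖ := by nlinarith
  rcases min_choice (t a) (t b) with h7 | h7 <;> rw [h7] at h6 <;> nlinarith


lemma hk_mono {f f' : ℝ → ℝ} {a b : ℝ} (hab : a ≤ b)
    (hf : ∀ x ∈ Icc a b, HasDerivAt f (f' x) x) (h0 : ∀ x ∈ Icc a b, 0 ≤ f' x) : f a ≤ f b := by
  have : MonotoneOn f (Icc a b) := by
    refine monotoneOn_of_hasDerivWithinAt_nonneg (f' := f') (convex_Icc a b)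
      (fun x hx => (hf x hx).continuousAt.continuousWithinAt) ?_ ?_
    · intro x hx; exact (hf x (interior_subset hx)).hasDerivWithinAt
    · intro x hx; exact h0 x (interior_subset hx)
  exact this (left_mem_Icc.2 hab) (right_mem_Icc.2 hab) hab

lemma hk_isOpen_disc : IsOpen unitDisc := Metric.isOpen_ball

lemma hk_mem_disc {z : ℂ} : z ∈ unitDisc ↔ ‖z‖ < 1 := by simp [unitDisc]

lemma hk_rot {ω φ : ℂ → ℝ} {τ : ℝ → ℝ} (hW : IsClassW ω φ τ) {z : ℂ} (hz : z ∈ unitDisc) :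
    fderiv ℝ φ z (Complex.I * z) = 0 := by
  have hd : DifferentiableAt ℝ φ z :=
    (hW.smooth.contDiffAt (hk_isOpen_disc.mem_nhds hz)).differentiableAt (by norm_num)
  have hcurve : HasDerivAt (fun θ : ℝ => Complex.exp (θ * Complex.I) * z) (Complex.I * z) 0 := by
    have h1 : HasDerivAt (fun θ : ℝ => (θ : ℂ) * Complex.I) Complex.I 0 := by
      simpa using (Complex.ofRealCLM.hasDerivAt (x := (0 : ℝ))).mul_const Complex.I
    have h2 := (h1.cexp).mul_const z
    simpa using h2
  have hd0 : HasFDerivAt φ (fderiv ℝ φ z) ((fun θ : ℝ => Complex.exp (θ * Complex.I) * z) 0) := by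
    simpa using hd.hasFDerivAt
  have h := hd0.comp_hasDerivAt (0 : ℝ) hcurve
  have hconst : (φ ∘ fun θ : ℝ => Complex.exp (θ * Complex.I) * z) = fun _ => φ z := by
    funext θ
    have hn : ‖Complex.exp (θ * Complex.I) * z‖ = ‖z‖ := by
      rw [norm_mul, Complex.norm_exp_ofReal_mul_I, one_mul]
    exact hW.radial _ (by rw [hk_mem_disc, hn]; exact hk_mem_disc.1 hz) _ hz hn
  rw [hconst] at h
  exact h.unique (hasDerivAt_const 0 (φ z))

/-- `ρ(r) = r times the radial derivative`. -/
def hkRho (φ : ℂ → ℝ) (r : ℝ) : ℝ := r * fderiv ℝ φ (r : ℂ) 1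

lemma hk_real_mem {r : ℝ} (hr : r ∈ Ico (0 : ℝ) 1) : (r : ℂ) ∈ unitDisc := by
  rw [hk_mem_disc, Complex.norm_real, Real.norm_eq_abs, abs_of_nonneg hr.1]; exact hr.2

lemma hk_d1 {ω φ : ℂ → ℝ} {τ : ℝ → ℝ} (hW : IsClassW ω φ τ) {r : ℝ} (hr : r ∈ Ioo (0 : ℝ) 1) :
    HasDerivAt (fun x : ℝ => φ (x : ℂ)) (hkRho φ r / r) r := by
  have hd : DifferentiableAt ℝ φ (r : ℂ) :=
    (hW.smooth.contDiffAt (hk_isOpen_disc.mem_nhds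
      (hk_real_mem ⟨hr.1.le, hr.2⟩))).differentiableAt (by norm_num)
  have h := hd.hasFDerivAt.comp_hasDerivAt r (Complex.ofRealCLM.hasDerivAt (x := r))
  have : hkRho φ r / r = fderiv ℝ φ (r : ℂ) 1 := by
    unfold hkRho; field_simp [hr.1.ne']
  rw [this]
  simp only [Complex.ofRealCLM_apply, Complex.ofReal_one] at h
  exact h

lemma hk_dd {ω φ : ℂ → ℝ} {τ : ℝ → ℝ} (hW : IsClassW ω φ τ) {z : ℂ} (hz : z ∈ unitDisc) :
    DifferentiableAt ℝ (fderiv ℝ φ) z :=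
  ((hW.smooth.contDiffAt (hk_isOpen_disc.mem_nhds hz)).fderiv_right
    (m := 1) (by norm_num)).differentiableAt (by norm_num)

lemma hk_d2 {ω φ : ℂ → ℝ} {τ : ℝ → ℝ} (hW : IsClassW ω φ τ) {r : ℝ} (hr : r ∈ Ico (0 : ℝ) 1) :
    HasDerivAt (hkRho φ) (r * laplacian φ r) r := by
  have hz := hk_real_mem hr
  have hdd := hk_dd hW hz
  set L := fderiv ℝ (fderiv ℝ φ) (r : ℂ) with hLdef
  have hL : HasFDerivAt (fderiv ℝ φ) L (r : ℂ) := hdd.hasFDerivAt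
  have hap : ∀ v : ℂ, fderiv ℝ (fun w => fderiv ℝ φ w v) (r : ℂ) v = L v v := by
    intro v
    have := (hL.clm_apply (hasFDerivAt_const v (r : ℂ))).fderiv
    rw [this]; simp
  have hlap : laplacian φ r = L 1 1 + L Complex.I Complex.I := by
    unfold laplacian; rw [hap, hap]
  have hmulI : HasFDerivAt (fun w : ℂ => Complex.I * w)
      (Complex.I • ContinuousLinearMap.id ℝ ℂ) (r : ℂ) :=
    (hasFDerivAt_id (r : ℂ)).const_mul Complex.I
  have hzero : HasFDerivAt (fun w : ℂ => fderiv ℝ φ w (Complex.I * w)) (0 : ℂ →L[ℝ] ℝ) (r : ℂ) := by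
    refine (hasFDerivAt_const (0 : ℝ) (r : ℂ)).congr_of_eventuallyEq ?_
    filter_upwards [hk_isOpen_disc.mem_nhds hz] with w hw
    exact hk_rot hW hw
  have heq := (hL.clm_apply hmulI).unique hzero
  have hI := congrArg (fun A : ℂ →L[ℝ] ℝ => A Complex.I) heq
  have e1 : (Complex.I * (r : ℂ)) = r • Complex.I := by
    rw [Complex.real_smul, mul_comm]
  have hkey : r * L Complex.I Complex.I = fderiv ℝ φ (r : ℂ) 1 := by
    have e2 : L Complex.I (Complex.I * (r : ℂ)) = r * L Complex.I Complex.I := by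
      rw [e1, map_smul, smul_eq_mul]
    simp at hI
    rw [e2] at hI
    linarith
  have h1 : HasDerivAt (fun x : ℝ => fderiv ℝ φ (x : ℂ) 1) (L 1 1) r := by
    have h2 := (hL.clm_apply (hasFDerivAt_const (1 : ℂ) (r : ℂ))).comp_hasDerivAt r
      (Complex.ofRealCLM.hasDerivAt (x := r))
    have e3 : ((fderiv ℝ φ (r : ℂ)) ∘SL (0 : ℂ →L[ℝ] ℂ) + L.flip (1 : ℂ)) (Complex.ofRealCLM 1)
        = L 1 1 := by simp
    rw [← e3]
    exact h2
  have h3 := (hasDerivAt_id r).mul h1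
  have h4 : r * laplacian φ r = 1 * fderiv ℝ φ (r : ℂ) 1 + r * L 1 1 := by
    rw [hlap, ← hkey]; ring
  rw [h4]
  exact h3

lemma hk_rho_nonneg {ω φ : ℂ → ℝ} {τ : ℝ → ℝ} (hW : IsClassW ω φ τ) {a b : ℝ} (ha : 0 ≤ a)
    (hab : a ≤ b) (hb : b < 1) : hkRho φ a ≤ hkRho φ b := by
  refine hk_mono hab (f' := fun r => r * laplacian φ r)
    (fun x hx => hk_d2 hW ⟨ha.trans hx.1, hx.2.trans_lt hb⟩) ?_
  intro x hx
  exact mul_nonneg (ha.trans hx.1)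
    (hW.lap_pos _ (hk_real_mem ⟨ha.trans hx.1, hx.2.trans_lt hb⟩)).le

/-- The radial phase. -/
def hkPhi (φ : ℂ → ℝ) (N : ℕ) (r₀ r : ℝ) : ℝ :=
  φ (r : ℂ) - φ (r₀ : ℂ) - N * (Real.log r - Real.log r₀)

lemma hk_dPhi {ω φ : ℂ → ℝ} {τ : ℝ → ℝ} (hW : IsClassW ω φ τ) (N : ℕ) (r₀ : ℝ) {r : ℝ}
    (hr : r ∈ Ioo (0 : ℝ) 1) :
    HasDerivAt (hkPhi φ N r₀) ((hkRho φ r - N) / r) r := by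
  have h1 := (hk_d1 hW hr).sub_const (φ (r₀ : ℂ))
  have h2 := ((Real.hasDerivAt_log hr.1.ne').sub_const (Real.log r₀)).const_mul (N : ℝ)
  have h3 := h1.sub h2
  have : (hkRho φ r - N) / r = hkRho φ r / r - N * r⁻¹ := by
    rw [sub_div]; rfl
  rw [this]; exact h3

lemma hk_inward {ω φ : ℂ → ℝ} {τ : ℝ → ℝ} (hW : IsClassW ω φ τ) {N : ℕ} {r₀ r : ℝ}
    (hr : 0 < r) (hrr : r ≤ r₀) (hr0 : r₀ < 1) (hN : hkRho φ r₀ ≤ N) :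
    0 ≤ hkPhi φ N r₀ r := by
  have h := hk_mono hrr (f := fun x => - hkPhi φ N r₀ x) (f' := fun x => -((hkRho φ x - N) / x))
    (fun x hx => (hk_dPhi hW N r₀ ⟨hr.trans_le hx.1, hx.2.trans_lt hr0⟩).neg) ?_
  · have h0 : hkPhi φ N r₀ r₀ = 0 := by simp [hkPhi]
    simp only [h0] at h
    linarith
  · intro x hx
    have hx0 := hr.trans_le hx.1
    have := hk_rho_nonneg hW hx0.le hx.2 hr0
    rw [neg_nonneg]
    exact div_nonpos_of_nonpos_of_nonneg (by linarith) hx0.le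

lemma hk_lap_bounds {ω φ : ℂ → ℝ} {τ : ℝ → ℝ} (hW : IsClassW ω φ τ) :
    ∃ b B : ℝ, 0 < b ∧ 0 < B ∧ ∀ r ∈ Ico (1 / 2 : ℝ) 1,
      b / τ r ^ 2 ≤ r * laplacian φ r ∧ r * laplacian φ r ≤ B / τ r ^ 2 := by
  obtain ⟨C, hC, h⟩ := hW.comp
  have hC0 : 0 < C := by linarith
  refine ⟨1 / (2 * C ^ 2), C ^ 2, by positivity, by positivity, fun r hr => ?_⟩
  have hr' : r ∈ Ico (0 : ℝ) 1 := ⟨by linarith [hr.1], hr.2⟩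
  have hz := hk_real_mem hr'
  have hl := hW.lap_pos _ hz
  have ht := hW.tau_pos r hr'
  obtain ⟨h1, h2⟩ := h _ hz
  have hn : ‖(r : ℂ)‖ = r := by
    rw [Complex.norm_real, Real.norm_eq_abs, abs_of_nonneg hr'.1]
  rw [hn] at h1 h2
  set l := laplacian φ r
  set s := l ^ (-(1 / 2 : ℝ)) with hs
  have hs0 : 0 < s := Real.rpow_pos_of_pos hl _
  have hsl : s ^ 2 * l = 1 := by
    rw [hs, ← Real.rpow_natCast, ← Real.rpow_mul hl.le]
    norm_num
    rw [Real.rpow_neg_one, inv_mul_cancel₀ hl.ne']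
  have hl' : l = 1 / s ^ 2 := by field_simp; linarith
  constructor
  · have h3 : s ^ 2 ≤ (C * τ r) ^ 2 := by gcongr
    have h4 : 1 / (C * τ r) ^ 2 ≤ l := by rw [hl']; gcongr
    calc 1 / (2 * C ^ 2) / τ r ^ 2 = 1 / 2 * (1 / (C * τ r) ^ 2) := by field_simp
      _ ≤ r * l := by gcongr; exacts [hr'.1, hr.1]
  · have h3 : (τ r / C) ^ 2 ≤ s ^ 2 := by gcongr
    have h4 : l ≤ 1 / (τ r / C) ^ 2 := by rw [hl']; gcongr
    calc r * l ≤ 1 * (1 / (τ r / C) ^ 2) := by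
          gcongr; exact hr.2.le
      _ = _ := by field_simp


lemma hk_tau_small {ω φ : ℂ → ℝ} {τ : ℝ → ℝ} (hW : IsClassW ω φ τ) {ε : ℝ} (hε : 0 < ε) :
    ∃ r₁ ∈ Ico (3 / 4 : ℝ) 1, ∀ r ∈ Ico r₁ 1, |deriv τ r| ≤ ε := by
  have h := hW.tau_deriv_lim.eventually (Metric.ball_mem_nhds (0 : ℝ) hε)
  obtain ⟨l, hl, hsub⟩ := (mem_nhdsLT_iff_exists_Ioo_subset).1 h
  have hl1 : l < 1 := hl
  refine ⟨max (3 / 4) ((l + 1) / 2), ⟨le_max_left _ _, max_lt (by norm_num) (by linarith)⟩, ?_⟩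
  intro r hr
  have h2 : (l + 1) / 2 ≤ r := (le_max_right _ _).trans hr.1
  have h3 := hsub ⟨by linarith, hr.2⟩
  have h4 : |deriv τ r| < ε := by simpa using h3
  exact h4.le

lemma hk_outward {ω φ : ℂ → ℝ} {τ : ℝ → ℝ} (hW : IsClassW ω φ τ) {b ε r₁ : ℝ} (hb : 0 < b)
    (hε : 0 < ε) (hbε : 2 * ε ^ 2 ≤ b) (hr1 : 1 / 2 ≤ r₁)
    (hlow : ∀ r ∈ Ico (1 / 2 : ℝ) 1, b / τ r ^ 2 ≤ r * laplacian φ r)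
    (hder : ∀ r ∈ Ico r₁ 1, |deriv τ r| ≤ ε) {N : ℕ} {r₀ r : ℝ} (h0 : r₁ ≤ r₀) (hrr : r₀ ≤ r)
    (hr : r < 1) (hN : N ≤ hkRho φ r₀ + 2) :
    Real.exp (-hkPhi φ N r₀ r) * Real.exp (8 * ((r - r₀) / τ r₀) + 8) ≤
      Real.exp (12 + (b / ε / 2 + 8) ^ 2 / b) * (τ r / τ r₀) := by
  set κ := b / ε with hκ
  have hκ0 : 0 < κ := by positivity
  have hI : ∀ x ∈ Icc r₀ r, x ∈ Ico (1 / 2 : ℝ) 1 ∧ x ∈ Ico r₁ 1 ∧ x ∈ Ico (0 : ℝ) 1 ∧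
      x ∈ Ioo (0 : ℝ) 1 := by
    intro x hx
    have h1 := hx.1
    have h2 := hx.2
    exact ⟨⟨by linarith, by linarith⟩, ⟨by linarith, by linarith⟩, ⟨by linarith, by linarith⟩,
      ⟨by linarith, by linarith⟩⟩
  have hm0 : r₀ ∈ Icc r₀ r := left_mem_Icc.2 hrr
  have hmr : r ∈ Icc r₀ r := right_mem_Icc.2 hrr
  have hτ : ∀ x ∈ Icc r₀ r, 0 < τ x := fun x hx => hW.tau_pos x (hI x hx).2.2.1
  have hτ0 := hτ r₀ hm0
  have hτr := hτ r hmr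
  have hanti : ∀ x ∈ Icc r₀ r, τ x ≤ τ r₀ := fun x hx =>
    hW.tau_anti (hI r₀ hm0).2.2.1 (hI x hx).2.2.1 hx.1
  have hder' : ∀ x ∈ Icc r₀ r, HasDerivAt τ (deriv τ x) x := fun x hx =>
    (hW.tau_diff x (hI x hx).2.2.1).hasDerivAt
  have hρ1 : ∀ x ∈ Icc r₀ r, b * (x - r₀) / τ r₀ ^ 2 ≤ hkRho φ x - hkRho φ r₀ := by
    intro y hy
    have hsub : Icc r₀ y ⊆ Icc r₀ r := Icc_subset_Icc le_rfl hy.2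
    have h := hk_mono hy.1 (f := fun x => hkRho φ x - b / τ r₀ ^ 2 * (x - r₀))
      (f' := fun x => x * laplacian φ x - b / τ r₀ ^ 2 * 1)
      (fun x hx => (hk_d2 hW (hI x (hsub hx)).2.2.1).sub
        (((hasDerivAt_id x).sub_const r₀).const_mul (b / τ r₀ ^ 2))) ?_
    · have e : b * (y - r₀) / τ r₀ ^ 2 = b / τ r₀ ^ 2 * (y - r₀) := by ring
      rw [e]
      simp only [sub_self, mul_zero, sub_zero] at h
      linarith
    · intro x hx
      have h1 := hlow x (hI x (hsub hx)).1
      have h2 : b / τ r₀ ^ 2 ≤ b / τ x ^ 2 := by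
        have := hτ x (hsub hx)
        have := hanti x (hsub hx)
        gcongr
      linarith
  have hρ2 : ∀ x ∈ Icc r₀ r, κ * (1 / τ x - 1 / τ r₀) ≤ hkRho φ x - hkRho φ r₀ := by
    intro y hy
    have hsub : Icc r₀ y ⊆ Icc r₀ r := Icc_subset_Icc le_rfl hy.2
    have h := hk_mono hy.1 (f := fun x => hkRho φ x - κ * (τ x)⁻¹)
      (f' := fun x => x * laplacian φ x - κ * (-deriv τ x / τ x ^ 2))
      (fun x hx => (hk_d2 hW (hI x (hsub hx)).2.2.1).sub
        (((hder' x (hsub hx)).inv (hτ x (hsub hx)).ne').const_mul κ)) ?_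
    · simp only [one_div]
      linarith
    · intro x hx
      have h1 := hlow x (hI x (hsub hx)).1
      have h2 := hder x (hI x (hsub hx)).2.1
      have h3 : -deriv τ x ≤ ε := by linarith [neg_abs_le (deriv τ x)]
      have ht := hτ x (hsub hx)
      have h4 : κ * (-deriv τ x / τ x ^ 2) ≤ κ * (ε / τ x ^ 2) := by gcongr
      have h5 : κ * (ε / τ x ^ 2) = b / τ x ^ 2 := by rw [hκ]; field_simp
      linarith
  have hdiv : ∀ x ∈ Icc r₀ r, hkRho φ x - hkRho φ r₀ - 4 ≤ (hkRho φ x - N) / x := by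
    intro x hx
    obtain ⟨h1, _, _, h4⟩ := hI x hx
    have hy : 0 ≤ hkRho φ x - hkRho φ r₀ := by
      have := hk_rho_nonneg hW (hI r₀ hm0).2.2.1.1 hx.1 h1.2
      linarith
    rw [le_div_iff₀ h4.1]
    have h5 := h1.1
    have h6 := h1.2
    nlinarith
  have hzero : hkPhi φ N r₀ r₀ = 0 := by simp [hkPhi]
  have hA : b * ((r - r₀) / τ r₀) ^ 2 / 2 - 4 ≤ hkPhi φ N r₀ r := by
    have h := hk_mono hrr
      (f := fun x => hkPhi φ N r₀ x - b / (2 * τ r₀ ^ 2) * (x - r₀) ^ 2 + 4 * (x - r₀))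
      (f' := fun x => (hkRho φ x - N) / x - b / (2 * τ r₀ ^ 2) * (2 * (x - r₀)) + 4 * 1)
      (fun x hx => by
        have h1 := hk_dPhi hW N r₀ (hI x hx).2.2.2
        have h2 := (hasDerivAt_id x).sub_const r₀
        have h3 := (h2.pow 2).const_mul (b / (2 * τ r₀ ^ 2))
        have h4 := (h1.sub h3).add (h2.const_mul (4 : ℝ))
        refine h4.congr_deriv ?_
        simp) ?_
    · simp only [hzero, sub_self] at h
      have e : b * ((r - r₀) / τ r₀) ^ 2 / 2 = b / (2 * τ r₀ ^ 2) * (r - r₀) ^ 2 := by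
        field_simp
      rw [e]
      have : r - r₀ ≤ 1 := by linarith [(hI r₀ hm0).1.1]
      norm_num at h
      linarith
    · intro x hx
      have h1 := hdiv x hx
      have h2 := hρ1 x hx
      have e : b / (2 * τ r₀ ^ 2) * (2 * (x - r₀)) = b * (x - r₀) / τ r₀ ^ 2 := by field_simp
      rw [e]; linarith
  have hB : 2 * (Real.log (τ r₀) - Real.log (τ r)) - κ * ((r - r₀) / τ r₀) - 4 ≤
      hkPhi φ N r₀ r := by
    have h := hk_mono hrr
      (f := fun x => hkPhi φ N r₀ x + 2 * Real.log (τ x) + (κ / τ r₀ + 4) * (x - r₀))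
      (f' := fun x => (hkRho φ x - N) / x + 2 * (deriv τ x / τ x) + (κ / τ r₀ + 4) * 1)
      (fun x hx => by
        have h1 := hk_dPhi hW N r₀ (hI x hx).2.2.2
        have h2 := (hasDerivAt_id x).sub_const r₀
        have h3 := ((hder' x hx).log (hτ x hx).ne').const_mul (2 : ℝ)
        exact (h1.add h3).add (h2.const_mul (κ / τ r₀ + 4))) ?_
    · simp only [hzero, sub_self] at h
      have e : κ * ((r - r₀) / τ r₀) = κ / τ r₀ * (r - r₀) := by ring
      rw [e]
      have : r - r₀ ≤ 1 := by linarith [(hI r₀ hm0).1.1]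
      nlinarith
    · intro x hx
      have h1 := hdiv x hx
      have h2 := hρ2 x hx
      have ht := hτ x hx
      have h3 : -ε ≤ deriv τ x := by linarith [hder x (hI x hx).2.1, neg_abs_le (deriv τ x)]
      have h4 : (-ε) / τ x ≤ deriv τ x / τ x := by gcongr
      have h5 : 2 * ε / τ x ≤ κ / τ x := by
        gcongr
        rw [hκ, le_div_iff₀ hε]; nlinarith
      have e1 : κ * (1 / τ x - 1 / τ r₀) = κ / τ x - κ / τ r₀ := by ring
      have e2 : 2 * ε / τ x = -2 * ((-ε) / τ x) := by ring
      rw [e1] at h2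
      rw [e2] at h5
      linarith
  set u := (r - r₀) / τ r₀ with hu
  have hquad : (κ / 2 + 8) * u - b * u ^ 2 / 4 ≤ (κ / 2 + 8) ^ 2 / b := by
    rw [le_div_iff₀ hb]
    nlinarith [sq_nonneg (κ / 2 + 8 - b * u / 2)]
  have e3 : τ r / τ r₀ = Real.exp (Real.log (τ r) - Real.log (τ r₀)) := by
    rw [Real.exp_sub, Real.exp_log hτr, Real.exp_log hτ0]
  rw [e3, ← Real.exp_add, ← Real.exp_add]
  apply Real.exp_le_exp.2
  nlinarith

lemma hk_near {ω φ : ℂ → ℝ} {τ : ℝ → ℝ} {c₁ c₂ : ℝ} (hW : IsClassW ω φ τ)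
    (hL : IsClassL (radialize τ) c₁ c₂) {δ B : ℝ} (hB : 0 < B) (hδ : 0 < δ) (hδ1 : δ ≤ 1 / 32)
    (hδc1 : δ * c₁ ≤ 1 / 32) (hδc2 : δ * c₂ ≤ 1 / 32)
    (hup : ∀ r ∈ Ico (1 / 2 : ℝ) 1, r * laplacian φ r ≤ B / τ r ^ 2)
    {N : ℕ} {r₀ r : ℝ} (h0 : 3 / 4 ≤ r₀) (h01 : r₀ < 1) (hr : |r - r₀| ≤ δ * τ r₀)
    (hN1 : hkRho φ r₀ ≤ N) (hN : N ≤ hkRho φ r₀ + 2) :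
    hkPhi φ N r₀ r ≤ 8 * B + 1 := by
  have hr0m : r₀ ∈ Ico (0 : ℝ) 1 := ⟨by linarith, h01⟩
  have ht0 := hW.tau_pos r₀ hr0m
  have hnorm : ∀ x ∈ Ico (0 : ℝ) 1, radialize τ (x : ℂ) = τ x := by
    intro x hx
    simp only [radialize]
    rw [Complex.norm_real, Real.norm_eq_abs, abs_of_nonneg hx.1]
  have hupp : τ r₀ ≤ c₁ * (1 - r₀) := by
    have := hL.upper _ (hk_real_mem hr0m)
    rw [hnorm _ hr0m, Complex.norm_real, Real.norm_eq_abs, abs_of_nonneg hr0m.1] at this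
    exact this
  have hs1 : δ * τ r₀ ≤ (1 - r₀) / 32 := by
    have : δ * τ r₀ ≤ δ * (c₁ * (1 - r₀)) := by gcongr
    nlinarith
  have hmem : ∀ x ∈ Icc (r₀ - δ * τ r₀) (r₀ + δ * τ r₀), x ∈ Ico (1 / 2 : ℝ) 1 := by
    intro x hx
    exact ⟨by linarith [hx.1], by linarith [hx.2]⟩
  have hmem' : ∀ x ∈ Icc (r₀ - δ * τ r₀) (r₀ + δ * τ r₀), x ∈ Ico (0 : ℝ) 1 := fun x hx =>
    ⟨by linarith [(hmem x hx).1], (hmem x hx).2⟩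
  have hconv : Convex ℝ (Icc (r₀ - δ * τ r₀) (r₀ + δ * τ r₀)) := convex_Icc _ _
  have hr0I : r₀ ∈ Icc (r₀ - δ * τ r₀) (r₀ + δ * τ r₀) := by
    constructor <;> nlinarith
  have hrI : r ∈ Icc (r₀ - δ * τ r₀) (r₀ + δ * τ r₀) := by
    obtain ⟨h1, h2⟩ := abs_le.1 hr
    constructor <;> linarith
  have htlow : ∀ x ∈ Icc (r₀ - δ * τ r₀) (r₀ + δ * τ r₀), τ r₀ / 2 ≤ τ x := by
    intro x hx
    have h1 := hL.lip _ (hk_real_mem hr0m) _ (hk_real_mem (hmem' x hx))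
    rw [hnorm _ hr0m, hnorm _ (hmem' x hx), ← Complex.ofReal_sub, Complex.norm_real,
      Real.norm_eq_abs] at h1
    have h2 : |r₀ - x| ≤ δ * τ r₀ := abs_le.2 ⟨by linarith [hx.2], by linarith [hx.1]⟩
    have h3 : c₂ * |r₀ - x| ≤ c₂ * (δ * τ r₀) := by
      have := hL.c₂_pos; gcongr
    have h4 := le_abs_self (τ r₀ - τ x)
    have h5 := mul_le_mul_of_nonneg_right hδc2 ht0.le
    linarith
  have hρ : ∀ x ∈ Icc (r₀ - δ * τ r₀) (r₀ + δ * τ r₀),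
      |hkRho φ x - hkRho φ r₀| ≤ 4 * B * δ / τ r₀ := by
    intro x hx
    have h1 := hconv.norm_image_sub_le_of_norm_hasDerivWithin_le
      (f := hkRho φ) (f' := fun x => x * laplacian φ x) (C := 4 * B / τ r₀ ^ 2)
      (fun y hy => (hk_d2 hW (hmem' y hy)).hasDerivWithinAt) (fun y hy => by
        have h2 := hup y (hmem y hy)
        have h3 : 0 ≤ y * laplacian φ y := mul_nonneg (hmem' y hy).1
          (hW.lap_pos _ (hk_real_mem (hmem' y hy))).le
        rw [Real.norm_eq_abs, abs_of_nonneg h3]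
        refine h2.trans ?_
        have h4 := htlow y hy
        have h5 : 0 < τ y := by linarith
        calc B / τ y ^ 2 ≤ B / (τ r₀ / 2) ^ 2 := by gcongr
          _ = 4 * B / τ r₀ ^ 2 := by field_simp; norm_num) hr0I hx
    rw [Real.norm_eq_abs, Real.norm_eq_abs] at h1
    have h2 : |x - r₀| ≤ δ * τ r₀ := abs_le.2 ⟨by linarith [hx.1], by linarith [hx.2]⟩
    calc _ ≤ 4 * B / τ r₀ ^ 2 * |x - r₀| := h1
      _ ≤ 4 * B / τ r₀ ^ 2 * (δ * τ r₀) := by gcongr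
      _ = _ := by field_simp
  have h1 := hconv.norm_image_sub_le_of_norm_hasDerivWithin_le
      (f := hkPhi φ N r₀) (f' := fun x => (hkRho φ x - N) / x)
      (C := 2 * (4 * B * δ / τ r₀ + 2))
      (fun y hy => (hk_dPhi hW N r₀
        ⟨by linarith [(hmem y hy).1], (hmem y hy).2⟩).hasDerivWithinAt) (fun y hy => by
        have h2 := hρ y hy
        have h3 := (hmem y hy).1
        have h6 : 0 < y := by linarith
        rw [Real.norm_eq_abs, abs_div, abs_of_pos h6, div_le_iff₀ h6]
        have h4 : |hkRho φ y - N| ≤ 4 * B * δ / τ r₀ + 2 := by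
          obtain ⟨a1, a2⟩ := abs_le.1 h2
          exact abs_le.2 ⟨by linarith, by linarith⟩
        have h5 : 0 ≤ 4 * B * δ / τ r₀ + 2 := by positivity
        nlinarith) hr0I hrI
  have hzero : hkPhi φ N r₀ r₀ = 0 := by simp [hkPhi]
  rw [hzero, sub_zero, Real.norm_eq_abs, Real.norm_eq_abs] at h1
  calc hkPhi φ N r₀ r ≤ |hkPhi φ N r₀ r| := le_abs_self _
    _ ≤ _ := h1
    _ ≤ 2 * (4 * B * δ / τ r₀ + 2) * (δ * τ r₀) := by gcongr
    _ = 8 * B * δ ^ 2 + 4 * (δ * τ r₀) := by field_simp; ring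
    _ ≤ 8 * B * 1 + 4 * (1 / 32) := by
        have hδ' : δ ^ 2 ≤ 1 := by nlinarith
        have : δ * τ r₀ ≤ 1 / 32 := by linarith
        gcongr
    _ ≤ _ := by linarith


/-- Normalized geometric sum. -/
def hkD (K : ℕ) (q : ℂ) : ℂ := (K : ℂ)⁻¹ * ∑ i ∈ Finset.range K, q ^ i

lemma hkD_le (K : ℕ) (hK : 0 < K) (q : ℂ) : ‖hkD K q‖ ≤ max 1 ‖q‖ ^ K := by
  have hK' : (0 : ℝ) < K := by exact_mod_cast hK
  unfold hkD
  rw [norm_mul, norm_inv, Complex.norm_natCast, inv_mul_le_iff₀ hK']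
  refine (norm_sum_le _ _).trans ?_
  calc ∑ i ∈ Finset.range K, ‖q ^ i‖ ≤ ∑ i ∈ Finset.range K, max 1 ‖q‖ ^ K := by
        refine Finset.sum_le_sum fun i hi => ?_
        rw [norm_pow]
        calc ‖q‖ ^ i ≤ max 1 ‖q‖ ^ i := by gcongr; exact le_max_right _ _
          _ ≤ _ := pow_le_pow_right₀ (le_max_left _ _) (Finset.mem_range.1 hi).le
    _ = _ := by simp

lemma hkD_le2 (K : ℕ) (hK : 0 < K) (q : ℂ) :
    ‖hkD K q‖ * (K * ‖1 - q‖) ≤ 2 * max 1 ‖q‖ ^ K := by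
  have hK' : (0 : ℝ) < K := by exact_mod_cast hK
  have hKc : (K : ℂ) ≠ 0 := by exact_mod_cast hK.ne'
  have e : hkD K q * (K * (1 - q)) = 1 - q ^ K := by
    unfold hkD
    rw [← geom_sum_mul_neg q K]; field_simp
  have e2 : ‖hkD K q‖ * (K * ‖1 - q‖) = ‖1 - q ^ K‖ := by
    rw [← e, norm_mul, norm_mul, Complex.norm_natCast]
  rw [e2]
  have h1 : (1 : ℝ) ≤ max 1 ‖q‖ ^ K := one_le_pow₀ (le_max_left _ _)
  have h2 : ‖q‖ ^ K ≤ max 1 ‖q‖ ^ K := by gcongr; exact le_max_right _ _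
  calc ‖1 - q ^ K‖ ≤ ‖(1 : ℂ)‖ + ‖q ^ K‖ := norm_sub_le _ _
    _ ≤ _ := by rw [norm_one, norm_pow]; linarith

lemma hkD_bound (K : ℕ) (hK : 0 < K) (q : ℂ) {s d : ℝ} (hs : 0 < s) (hKs : 1 / s ≤ K)
    (hd0 : 0 ≤ d) (hd : d ≤ ‖1 - q‖) :
    ‖hkD K q‖ ≤ max 1 ‖q‖ ^ K * (3 / (1 + d / s)) := by
  have h1 := hkD_le K hK q
  have h2 := hkD_le2 K hK q
  set M := max 1 ‖q‖ ^ K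
  set D := ‖hkD K q‖
  have hD : 0 ≤ D := norm_nonneg _
  have h3 : d / s ≤ K * ‖1 - q‖ := by
    calc d / s = 1 / s * d := by ring
      _ ≤ K * ‖1 - q‖ := by gcongr
  have h4 : D * (d / s) ≤ 2 * M := (mul_le_mul_of_nonneg_left h3 hD).trans h2
  have h5 : 0 ≤ d / s := by positivity
  rw [← mul_div_assoc, le_div_iff₀ (by positivity)]
  nlinarith

lemma hkD_near (K : ℕ) (hK : 0 < K) (q : ℂ) (hq : K * ‖q - 1‖ ≤ 1 / 8) :
    1 / 2 ≤ ‖hkD K q‖ := by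
  have hK' : (0 : ℝ) < K := by exact_mod_cast hK
  have hKc : (K : ℂ) ≠ 0 := by exact_mod_cast hK.ne'
  set x := ‖q - 1‖ with hx
  have hx0 : 0 ≤ x := norm_nonneg _
  have hqn : ‖q‖ ≤ 1 + x := by
    have := norm_add_le (q - 1) 1
    simp only [sub_add_cancel, norm_one] at this
    linarith
  have hpow : ∀ i : ℕ, ‖q ^ i - 1‖ ≤ (1 + x) ^ i - 1 := by
    intro i
    induction i with
    | zero => simp
    | succ i ih =>
      have e : q ^ (i + 1) - 1 = q * (q ^ i - 1) + (q - 1) := by ring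
      rw [e]
      calc _ ≤ ‖q * (q ^ i - 1)‖ + ‖q - 1‖ := norm_add_le _ _
        _ ≤ (1 + x) * ((1 + x) ^ i - 1) + x := by
          rw [norm_mul]; gcongr
        _ = _ := by ring
  have hexp : (1 + x) ^ K ≤ 3 / 2 := by
    calc (1 + x) ^ K ≤ (Real.exp x) ^ K := by gcongr; linarith [Real.add_one_le_exp x]
      _ = Real.exp (K * x) := by rw [← Real.exp_nat_mul]
      _ ≤ Real.exp (1 / 8) := Real.exp_le_exp.2 hq
      _ ≤ 3 / 2 := by
        have h := Real.exp_bound_div_one_sub_of_interval (x := 1 / 8) (by norm_num) (by norm_num)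
        norm_num at h ⊢
        linarith
  have e : hkD K q - 1 = (K : ℂ)⁻¹ * ∑ i ∈ Finset.range K, (q ^ i - 1) := by
    unfold hkD
    rw [Finset.sum_sub_distrib, mul_sub]
    simp [hKc]
  have h1 : ‖hkD K q - 1‖ ≤ 1 / 2 := by
    rw [e, norm_mul, norm_inv, Complex.norm_natCast, inv_mul_le_iff₀ hK']
    refine (norm_sum_le _ _).trans ?_
    calc ∑ i ∈ Finset.range K, ‖q ^ i - 1‖ ≤ ∑ i ∈ Finset.range K, (1 / 2 : ℝ) := by
          refine Finset.sum_le_sum fun i hi => (hpow i).trans ?_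
          have : (1 + x) ^ i ≤ (1 + x) ^ K :=
            pow_le_pow_right₀ (by linarith) (Finset.mem_range.1 hi).le
          linarith
      _ = _ := by simp
  have h2 := norm_sub_norm_le (1 : ℂ) (1 - hkD K q)
  rw [norm_one, norm_sub_rev 1 (hkD K q)] at h2
  simp only [sub_sub_cancel] at h2
  linarith

lemma hk_test {ω φ : ℂ → ℝ} {τ : ℝ → ℝ} {c₁ c₂ : ℝ} (hW : IsClassW ω φ τ)
    (hL : IsClassL (radialize τ) c₁ c₂) {δ : ℝ} (hδ : 0 < δ) (hδ1 : δ ≤ 1 / 32)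
    (hδc1 : δ * c₁ ≤ 1 / 32) (hδc2 : δ * c₂ ≤ 1 / 32) :
    ∃ r₁ < (1 : ℝ), ∃ C > (0 : ℝ), ∃ c > (0 : ℝ), ∀ α ∈ unitDisc, r₁ ≤ ‖α‖ →
      ∃ f : ℂ → ℂ, Differentiable ℂ f ∧
        (∀ z ∈ unitDisc, ‖f z‖ * Real.exp (-φ z) ≤ C * hkE (radialize τ) α z) ∧
        (∀ z, ‖z - α‖ < δ * radialize τ α → c ≤ ‖f z‖ * Real.exp (-φ z)) := by
  obtain ⟨b, B, hb, hB, hlap⟩ := hk_lap_bounds hW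
  set ε := Real.sqrt (b / 2) with hε
  have hε0 : 0 < ε := Real.sqrt_pos.2 (by positivity)
  have hε2 : 2 * ε ^ 2 ≤ b := by rw [hε, Real.sq_sqrt (by positivity)]; linarith
  obtain ⟨r₁, hr1, hder⟩ := hk_tau_small hW hε0
  set C₀ := Real.exp (12 + (b / ε / 2 + 8) ^ 2 / b) with hC₀
  have hC1 : 1 ≤ C₀ := Real.one_le_exp (by positivity)
  refine ⟨r₁, hr1.2, 81 * C₀, by positivity, Real.exp (-(8 * B + 1)) * (1 / 2) ^ 4,
    by positivity, ?_⟩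
  intro α hα hrα
  set r₀ := ‖α‖ with hr₀
  have hα1 : r₀ < 1 := hk_mem_disc.1 hα
  have hr34 : 3 / 4 ≤ r₀ := hr1.1.trans hrα
  have hr0pos : 0 < r₀ := by linarith
  have hα0 : α ≠ 0 := norm_pos_iff.1 hr0pos
  have hr0m : r₀ ∈ Ico (0 : ℝ) 1 := ⟨hr0pos.le, hα1⟩
  have ht0 : 0 < τ r₀ := hW.tau_pos _ hr0m
  have htα : radialize τ α = τ r₀ := rfl
  set K := ⌈1 / τ r₀⌉₊ with hK
  have hK1 : 1 / τ r₀ ≤ K := Nat.le_ceil _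
  have hK2 : (K : ℝ) ≤ 1 / τ r₀ + 1 := (Nat.ceil_lt_add_one (by positivity)).le
  have hKpos : 0 < K := Nat.ceil_pos.2 (by positivity)
  have hρ0 : 0 ≤ hkRho φ r₀ := by
    have := hk_rho_nonneg hW le_rfl hr0pos.le hα1
    simpa [hkRho] using this
  set N := ⌈hkRho φ r₀⌉₊ + 1 with hN
  have hN1 : hkRho φ r₀ ≤ N := by
    have := Nat.le_ceil (hkRho φ r₀)
    rw [hN]; push_cast; linarith
  have hN2 : (N : ℝ) ≤ hkRho φ r₀ + 2 := by
    have := Nat.ceil_lt_add_one hρ0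
    rw [hN]; push_cast; linarith
  have hφrad : ∀ z ∈ unitDisc, φ z = φ ((‖z‖ : ℝ) : ℂ) := by
    intro z hz
    have hm : ‖z‖ ∈ Ico (0 : ℝ) 1 := ⟨norm_nonneg _, hk_mem_disc.1 hz⟩
    exact hW.radial _ hz _ (hk_real_mem hm) (by simp)
  refine ⟨fun z => (Real.exp (φ r₀) : ℂ) * ((z / α) ^ N * hkD K (z / α) ^ 4), ?_, ?_, ?_⟩
  · unfold hkD; fun_prop
  · intro z hz
    have hz1 := hk_mem_disc.1 hz
    have hqn : ‖z / α‖ = ‖z‖ / r₀ := by rw [norm_div]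
    rcases eq_or_ne z 0 with rfl | hz0
    · have : (0 : ℂ) ^ N = 0 := by rw [hN]; simp
      simp only [zero_div, this, zero_mul, mul_zero, norm_zero]
      exact mul_nonneg (by positivity) (hkE_nonneg (hL.pos _ hα) (hL.pos _ hz))
    have hzpos : 0 < ‖z‖ := norm_pos_iff.2 hz0
    have hzm : ‖z‖ ∈ Ico (0 : ℝ) 1 := ⟨hzpos.le, hz1⟩
    have hval : ‖(Real.exp (φ r₀) : ℂ) * ((z / α) ^ N * hkD K (z / α) ^ 4)‖ * Real.exp (-φ z) =
        Real.exp (-hkPhi φ N r₀ ‖z‖) * ‖hkD K (z / α)‖ ^ 4 := by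
      rw [norm_mul, norm_mul, norm_pow, norm_pow, hqn, Complex.norm_real, Real.norm_eq_abs,
        abs_of_pos (Real.exp_pos _), hφrad z hz]
      have : (‖z‖ / r₀) ^ N = Real.exp (N * (Real.log ‖z‖ - Real.log r₀)) := by
        rw [Real.exp_nat_mul, Real.exp_sub, Real.exp_log hzpos, Real.exp_log hr0pos]
      rw [this]
      have e : -hkPhi φ N r₀ ‖z‖ = φ r₀ + N * (Real.log ‖z‖ - Real.log r₀) + -φ ((‖z‖ : ℝ) : ℂ) := by
        simp only [hkPhi]; ring
      rw [e, Real.exp_add, Real.exp_add]; ring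
    rw [hval]
    have hd : ‖z - α‖ ≤ ‖1 - z / α‖ := by
      have : 1 - z / α = (α - z) / α := by field_simp
      rw [this, norm_div, norm_sub_rev, le_div_iff₀ hr0pos]
      nlinarith [norm_nonneg (α - z)]
    have hDb := hkD_bound K hKpos (z / α) ht0 hK1 (norm_nonneg (z - α)) hd
    have hDb4 : ‖hkD K (z / α)‖ ^ 4 ≤
        (max 1 ‖z / α‖ ^ K) ^ 4 * (81 * (1 / (1 + ‖z - α‖ / τ r₀) ^ 4)) := by
      calc _ ≤ (max 1 ‖z / α‖ ^ K * (3 / (1 + ‖z - α‖ / τ r₀))) ^ 4 := by gcongr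
        _ = _ := by rw [mul_pow, div_pow]; ring
    unfold hkE
    rw [htα, show radialize τ z = τ ‖z‖ from rfl]
    rcases le_total ‖z‖ r₀ with hle | hge
    · have hΦ := hk_inward hW hzpos hle hα1 hN1
      have hq1 : max 1 ‖z / α‖ = 1 := by
        rw [hqn]; exact max_eq_left ((div_le_one hr0pos).2 hle)
      rw [hq1, one_pow, one_pow, one_mul] at hDb4
      have hmin : min (τ ‖z‖) (τ r₀) / τ r₀ = 1 := by
        rw [min_eq_right (hW.tau_anti hzm hr0m hle), div_self ht0.ne']
      rw [hmin, one_mul]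
      calc _ ≤ 1 * (81 * (1 / (1 + ‖z - α‖ / τ r₀) ^ 4)) := by
            gcongr
            exact Real.exp_le_one_iff.2 (by linarith)
        _ ≤ C₀ * (81 * (1 / (1 + ‖z - α‖ / τ r₀) ^ 4)) := by gcongr
        _ = _ := by ring
    · have hout := hk_outward hW hb hε0 hε2 (by linarith [hr1.1]) (fun r hr => (hlap r hr).1)
        hder hrα hge hz1 hN2
      have hq1 : max 1 ‖z / α‖ = ‖z‖ / r₀ := by
        rw [hqn]; exact max_eq_right ((one_le_div hr0pos).2 hge)
      have hqK : ((‖z‖ / r₀) ^ K) ^ 4 ≤ Real.exp (8 * ((‖z‖ - r₀) / τ r₀) + 8) := by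
        have h1 : ‖z‖ / r₀ ≤ Real.exp (2 * (‖z‖ - r₀)) := by
          refine le_trans ?_ (Real.add_one_le_exp _)
          rw [div_le_iff₀ hr0pos]
          nlinarith
        have h2 : (‖z‖ - r₀) ≤ 1 := by linarith
        calc ((‖z‖ / r₀) ^ K) ^ 4 ≤ ((Real.exp (2 * (‖z‖ - r₀))) ^ K) ^ 4 := by gcongr
          _ = Real.exp (K * (8 * (‖z‖ - r₀))) := by
            rw [← Real.exp_nat_mul, ← Real.exp_nat_mul]; congr 1; push_cast; ring
          _ ≤ Real.exp ((1 / τ r₀ + 1) * (8 * (‖z‖ - r₀))) := by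
            apply Real.exp_le_exp.2; gcongr
          _ ≤ _ := by
            apply Real.exp_le_exp.2
            have : (1 / τ r₀ + 1) * (8 * (‖z‖ - r₀)) =
              8 * ((‖z‖ - r₀) / τ r₀) + 8 * (‖z‖ - r₀) := by ring
            rw [this]; linarith
      rw [hq1] at hDb4
      rw [min_eq_left (hW.tau_anti hr0m hzm hge)]
      set P := (81 * (1 / (1 + ‖z - α‖ / τ r₀) ^ 4)) with hP
      have hP0 : 0 ≤ P := by positivity
      calc _ ≤ Real.exp (-hkPhi φ N r₀ ‖z‖) * (Real.exp (8 * ((‖z‖ - r₀) / τ r₀) + 8) * P) := by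
            gcongr
            exact hDb4.trans (by gcongr)
        _ = (Real.exp (-hkPhi φ N r₀ ‖z‖) * Real.exp (8 * ((‖z‖ - r₀) / τ r₀) + 8)) * P := by ring
        _ ≤ C₀ * (τ ‖z‖ / τ r₀) * P := by gcongr
        _ = _ := by rw [hP]; ring
  · intro z hzα
    rw [htα] at hzα
    have hz : z ∈ unitDisc := hk_disc_sub hL (by linarith) hα hzα hδ
    have hz1 := hk_mem_disc.1 hz
    have hqn : ‖z / α‖ = ‖z‖ / r₀ := by rw [norm_div]
    have hupp : τ r₀ ≤ c₁ * (1 - r₀) := hL.upper α hα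
    have hdist : |‖z‖ - r₀| ≤ δ * τ r₀ := (abs_norm_sub_norm_le z α).trans hzα.le
    have hδτ : δ * τ r₀ ≤ 1 / 32 := by
      have : δ * τ r₀ ≤ δ * (c₁ * (1 - r₀)) := by gcongr
      have h2 := hL.c₁_pos
      nlinarith [mul_pos hδ h2]
    have hzpos : 0 < ‖z‖ := by linarith [(abs_le.1 hdist).1]
    have hval : ‖(Real.exp (φ r₀) : ℂ) * ((z / α) ^ N * hkD K (z / α) ^ 4)‖ * Real.exp (-φ z) =
        Real.exp (-hkPhi φ N r₀ ‖z‖) * ‖hkD K (z / α)‖ ^ 4 := by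
      rw [norm_mul, norm_mul, norm_pow, norm_pow, hqn, Complex.norm_real, Real.norm_eq_abs,
        abs_of_pos (Real.exp_pos _), hφrad z hz]
      have : (‖z‖ / r₀) ^ N = Real.exp (N * (Real.log ‖z‖ - Real.log r₀)) := by
        rw [Real.exp_nat_mul, Real.exp_sub, Real.exp_log hzpos, Real.exp_log hr0pos]
      rw [this]
      have e : -hkPhi φ N r₀ ‖z‖ = φ r₀ + N * (Real.log ‖z‖ - Real.log r₀) + -φ ((‖z‖ : ℝ) : ℂ) := by
        simp only [hkPhi]; ring
      rw [e, Real.exp_add, Real.exp_add]; ring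
    rw [hval]
    have hΦ := hk_near hW hL hB hδ hδ1 hδc1 hδc2 (fun r hr => (hlap r hr).2) hr34 hα1 hdist hN1 hN2
    have hD := hkD_near K hKpos (z / α) (by
      have e : z / α - 1 = (z - α) / α := by field_simp
      rw [e, norm_div]
      have h1 : ‖z - α‖ / ‖α‖ ≤ 2 * (δ * τ r₀) := by
        rw [div_le_iff₀ hr0pos]
        nlinarith [norm_nonneg (z - α)]
      calc (K : ℝ) * (‖z - α‖ / ‖α‖) ≤ (1 / τ r₀ + 1) * (2 * (δ * τ r₀)) := by gcongr
        _ = 2 * δ + 2 * (δ * τ r₀) := by field_simp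
        _ ≤ 1 / 8 := by linarith)
    gcongr

/-! ### Operator theoretic part -/

lemma hk_sing {E F : Type} [NormedAddCommGroup E] [NormedSpace ℂ E]
    [NormedAddCommGroup F] [NormedSpace ℂ F] (T : E →L[ℂ] F) (S : Finset ℕ) (hS : S.Nonempty)
    (v : ℕ → E) (Cu m : ℝ) (hCu : 0 < Cu)
    (hup : ∀ a : ℕ → ℂ, ‖∑ k ∈ S, a k • v k‖ ^ 2 ≤ Cu * ∑ k ∈ S, ‖a k‖ ^ 2)
    (hlow : ∀ a : ℕ → ℂ, m * ∑ k ∈ S, ‖a k‖ ^ 2 ≤ ‖T (∑ k ∈ S, a k • v k)‖ ^ 2) :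
    Real.sqrt (m / Cu) ≤ singularNumber T (S.card - 1) := by
  unfold singularNumber
  refine le_csInf ⟨‖T - 0‖, 0, ?_, rfl⟩ ?_
  · have : LinearMap.range ((0 : E →L[ℂ] F) : E →ₗ[ℂ] F) = ⊥ := by
      simp
    rw [this]; simp
  rintro _ ⟨K, hK, rfl⟩
  let A : (S → ℂ) →ₗ[ℂ] E := Fintype.linearCombination ℂ (fun k : S => v k)
  let L : (S → ℂ) →ₗ[ℂ] LinearMap.range (K : E →ₗ[ℂ] F) :=
    (LinearMap.rangeRestrict (K : E →ₗ[ℂ] F)).comp A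
  have hcard := hS.card_pos
  have hni : ¬ Function.Injective L := by
    intro hinj
    have h1 := LinearMap.rank_le_of_injective L hinj
    have h2 : (S.card : Cardinal) ≤ ((S.card - 1 : ℕ) : Cardinal) := by
      refine le_trans ?_ (h1.trans hK)
      simp
    have h3 := Nat.cast_le.1 h2
    omega
  rw [← LinearMap.ker_eq_bot, Submodule.eq_bot_iff] at hni
  push Not at hni
  obtain ⟨a, ha, hane⟩ := hni
  let a' : ℕ → ℂ := fun k => if h : k ∈ S then a ⟨k, h⟩ else 0
  have hAa : A a = ∑ k ∈ S, a' k • v k := by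
    rw [← Finset.sum_coe_sort S]
    simp only [A, Fintype.linearCombination_apply]
    refine Finset.sum_congr rfl fun k _ => ?_
    simp [a']
  have hKA : K (A a) = 0 := by
    have : L a = 0 := ha
    have := congrArg Subtype.val this
    simpa [L] using this
  have hpos : 0 < ∑ k ∈ S, ‖a' k‖ ^ 2 := by
    obtain ⟨i, hi⟩ := Function.ne_iff.1 hane
    refine Finset.sum_pos' (fun _ _ => by positivity) ⟨i, i.2, ?_⟩
    have : a' i = a i := by simp [a']
    rw [this]
    have : 0 < ‖a i‖ := norm_pos_iff.2 hi
    positivity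
  have h1 := hup a'
  have h2 := hlow a'
  rw [← hAa] at h1 h2
  have h3 : T (A a) = (T - K) (A a) := by simp [hKA]
  have h4 : ‖T (A a)‖ ≤ ‖T - K‖ * ‖A a‖ := by
    rw [h3]; exact (T - K).le_opNorm _
  refine Real.sqrt_le_iff.2 ⟨norm_nonneg _, ?_⟩
  rw [div_le_iff₀ hCu]
  have h5 : m * ∑ k ∈ S, ‖a' k‖ ^ 2 ≤ (‖T - K‖ ^ 2 * Cu) * ∑ k ∈ S, ‖a' k‖ ^ 2 := by
    calc _ ≤ _ := h2
      _ ≤ (‖T - K‖ * ‖A a‖) ^ 2 := by gcongr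
      _ = ‖T - K‖ ^ 2 * ‖A a‖ ^ 2 := by ring
      _ ≤ ‖T - K‖ ^ 2 * (Cu * ∑ k ∈ S, ‖a' k‖ ^ 2) := by gcongr
      _ = _ := by ring
  exact le_of_mul_le_mul_right h5 hpos

lemma hk_cs (S : Finset ℕ) (e b : ℕ → ℝ) (he : ∀ k ∈ S, 0 ≤ e k) :
    (∑ k ∈ S, b k * e k) ^ 2 ≤ (∑ k ∈ S, e k) * ∑ k ∈ S, b k ^ 2 * e k := by
  have := Finset.sum_sq_le_sum_mul_sum_of_sq_eq_mul S (r := fun k => b k * e k) (f := e)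
    (g := fun k => b k ^ 2 * e k) he (fun k hk => mul_nonneg (sq_nonneg _) (he k hk))
    (fun k _ => by ring)
  exact this

lemma hk_offdiag {t : ℂ → ℝ} {c₁ c₂ : ℝ} (hL : IsClassL t c₁ c₂) {δ : ℝ} (hδ : 0 < δ)
    (hδ1 : δ ≤ 1 / 4) (hδ2 : δ * c₂ ≤ 1 / 4) (z : ℕ → ℂ) (hz : ∀ j, z j ∈ unitDisc)
    (hsep : ∀ j k, j ≠ k → δ * t (z k) ≤ ‖z j - z k‖) (S : Finset ℕ) (R : ℝ) (hR : 0 < R)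
    (hRsep : ∀ j ∈ S, ∀ k ∈ S, j ≠ k → R * min (t (z j)) (t (z k)) ≤ ‖z j - z k‖) (b : ℕ → ℝ) :
    ∑ j ∈ S, t (z j) ^ 2 * (∑ k ∈ S.erase j, b k / t (z k) * hkE t (z k) (z j)) ^ 2 ≤
      (1 + c₂) ^ 3 * (32 * hkI / (Real.pi * δ ^ 2)) * ((32 * hkI / (Real.pi * δ ^ 2)) / R) *
        ∑ k ∈ S, b k ^ 2 := by
  set G := 32 * hkI / (Real.pi * δ ^ 2) with hG
  have hG0 : 0 ≤ G := by have := hkI_nonneg; positivity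
  have hc := hL.c₂_pos
  have hE : ∀ j k, 0 ≤ hkE t (z k) (z j) := fun j k => hkE_nonneg (hL.pos _ (hz k)) (hL.pos _ (hz j))
  calc _ ≤ ∑ j ∈ S, ∑ k ∈ S.erase j, (1 + c₂) ^ 3 * G *
        (b k ^ 2 / t (z k) ^ 2 * (t (z j) ^ 2 * hkE t (z k) (z j))) := by
        refine Finset.sum_le_sum fun j hj => ?_
        have h1 := hk_cs (S.erase j) (fun k => hkE t (z k) (z j)) (fun k => b k / t (z k))
          (fun k _ => hE j k)
        have h2 := hkE_row hL hδ hδ1 hδ2 z hz hsep (S.erase j) (z j) (hz j)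
        rw [← Finset.mul_sum]
        have h3 : 0 ≤ ∑ k ∈ S.erase j, (b k / t (z k)) ^ 2 * hkE t (z k) (z j) :=
          Finset.sum_nonneg fun k _ => mul_nonneg (sq_nonneg _) (hE j k)
        calc _ ≤ t (z j) ^ 2 * (((1 + c₂) ^ 3 * G) *
              ∑ k ∈ S.erase j, (b k / t (z k)) ^ 2 * hkE t (z k) (z j)) := by
              gcongr
              exact h1.trans (mul_le_mul_of_nonneg_right h2 h3)
          _ = _ := by
              rw [mul_left_comm, Finset.mul_sum]
              congr 1
              refine Finset.sum_congr rfl fun k _ => ?_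
              rw [div_pow]; ring
    _ = ∑ k ∈ S, ∑ j ∈ S.erase k, (1 + c₂) ^ 3 * G *
        (b k ^ 2 / t (z k) ^ 2 * (t (z j) ^ 2 * hkE t (z k) (z j))) := by
        refine Finset.sum_comm' ?_
        intro x y; simp only [Finset.mem_erase]; tauto
    _ ≤ ∑ k ∈ S, (1 + c₂) ^ 3 * G * (G / R) * b k ^ 2 := by
        refine Finset.sum_le_sum fun k hk => ?_
        have h1 := hkE_col hL hδ hδ1 hδ2 z hz hsep S k R hR (fun j hj hjk => hRsep j hj k hk hjk)
        have htk := hL.pos _ (hz k)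
        rw [← Finset.mul_sum, ← Finset.mul_sum]
        calc _ ≤ (1 + c₂) ^ 3 * G * (b k ^ 2 / t (z k) ^ 2 * (G / R * t (z k) ^ 2)) := by gcongr
          _ = _ := by field_simp
    _ = _ := by rw [Finset.mul_sum]

lemma hk_local {t : ℂ → ℝ} {δ : ℝ} {g f r U : ℂ → ℂ} {e : ℂ → ℝ} {α b : ℂ} {c ρ : ℝ}
    (hc : 0 < c) (he : ∀ w, 0 ≤ e w)
    (hf : DifferentiableOn ℂ f (Metric.ball α (δ * t α)))
    (hr : DifferentiableOn ℂ r (Metric.ball α (δ * t α)))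
    (hU : DifferentiableOn ℂ U (Metric.ball α (δ * t α)))
    (hfc : ∀ w ∈ Metric.ball α (δ * t α), c ≤ ‖f w‖ * e w)
    (hrρ : ∀ w ∈ Metric.ball α (δ * t α), ‖r w‖ * e w ≤ ρ)
    (hg : AEMeasurable g (dA.restrict (Metric.ball α (δ * t α))))
    (hF0 : FdeltaSqE t δ g α ≠ 0) (hF1 : FdeltaSqE t δ g α ≠ ⊤) :
    ENNReal.ofReal (c ^ 2 / 2 * ‖b‖ ^ 2) * FdeltaSqE t δ g α ≤
      (ENNReal.ofReal ((δ * t α) ^ 2))⁻¹ * ∫⁻ w in Metric.ball α (δ * t α),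
        ENNReal.ofReal (e w ^ 2 * ‖g w * (b * f w + r w) - U w‖ ^ 2) ∂dA +
      ENNReal.ofReal (2 * ρ ^ 2) * FdeltaSqE t δ g α := by
  set F := FdeltaSqE t δ g α with hF
  set D := Metric.ball α (δ * t α) with hD
  by_cases hb : b = 0
  · simp [hb]
  have hlt : F < 2 * F := by
    have := ENNReal.lt_add_right hF1 hF0
    rwa [← two_mul] at this
  have hlt2 : FdeltaSqE t δ g α < 2 * F := hlt
  unfold FdeltaSqE at hlt2
  simp only [iInf_lt_iff] at hlt2
  obtain ⟨h, hh, hlt2⟩ := hlt2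
  have hfne : ∀ w ∈ D, f w ≠ 0 := by
    intro w hw h0
    have := hfc w hw
    rw [h0] at this
    simp at this
    linarith
  set H : ℂ → ℂ := fun w => (U w - r w * h w) / (b * f w) with hH
  have hHd : DifferentiableOn ℂ H D :=
    (hU.sub (hr.mul hh)).div (hf.const_mul b) (fun w hw => mul_ne_zero hb (hfne w hw))
  have hFle : F ≤ localMeanE t δ (fun w => g w - H w) α := iInf₂_le H hHd
  have hpt : ∀ w ∈ D, ENNReal.ofReal (c ^ 2 / 2 * ‖b‖ ^ 2) * ENNReal.ofReal (‖g w - H w‖ ^ 2) ≤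
      ENNReal.ofReal (e w ^ 2 * ‖g w * (b * f w + r w) - U w‖ ^ 2) +
        ENNReal.ofReal (ρ ^ 2) * ENNReal.ofReal (‖g w - h w‖ ^ 2) := by
    intro w hw
    rw [← ENNReal.ofReal_mul (by positivity), ← ENNReal.ofReal_mul (by positivity),
      ← ENNReal.ofReal_add (by positivity) (by positivity)]
    apply ENNReal.ofReal_le_ofReal
    have hid : b * f w * (g w - H w) = (g w * (b * f w + r w) - U w) - r w * (g w - h w) := by
      have := hfne w hw
      simp only [hH]
      field_simp
      ring
    have hn : ‖b‖ * ‖f w‖ * ‖g w - H w‖ ≤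
        ‖g w * (b * f w + r w) - U w‖ + ‖r w‖ * ‖g w - h w‖ := by
      rw [← norm_mul, ← norm_mul, ← norm_mul, hid]
      exact norm_sub_le _ _
    set x := ‖g w * (b * f w + r w) - U w‖
    have hew := he w
    have h1 : ‖b‖ * c * ‖g w - H w‖ ≤ e w * x + ρ * ‖g w - h w‖ := by
      calc ‖b‖ * c * ‖g w - H w‖ ≤ ‖b‖ * (‖f w‖ * e w) * ‖g w - H w‖ := by
            gcongr; exact hfc w hw
        _ = e w * (‖b‖ * ‖f w‖ * ‖g w - H w‖) := by ring
        _ ≤ e w * (x + ‖r w‖ * ‖g w - h w‖) := by gcongr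
        _ = e w * x + (‖r w‖ * e w) * ‖g w - h w‖ := by ring
        _ ≤ _ := by gcongr; exact hrρ w hw
    have h2 : (‖b‖ * c * ‖g w - H w‖) ^ 2 ≤ (e w * x + ρ * ‖g w - h w‖) ^ 2 :=
      pow_le_pow_left₀ (by positivity) h1 2
    nlinarith [sq_nonneg (e w * x - ρ * ‖g w - h w‖)]
  have hmeas : AEMeasurable (fun w => ENNReal.ofReal (ρ ^ 2) * ENNReal.ofReal (‖g w - h w‖ ^ 2))
      (dA.restrict D) := by
    have hhm : AEMeasurable h (dA.restrict D) :=
      hh.continuousOn.aemeasurable Metric.isOpen_ball.measurableSet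
    exact (((hg.sub hhm).norm.pow_const 2).ennreal_ofReal).const_mul _
  have hIntg : ENNReal.ofReal (c ^ 2 / 2 * ‖b‖ ^ 2) *
        ∫⁻ w in D, ENNReal.ofReal (‖g w - H w‖ ^ 2) ∂dA ≤
      ∫⁻ w in D, ENNReal.ofReal (e w ^ 2 * ‖g w * (b * f w + r w) - U w‖ ^ 2) ∂dA +
        ENNReal.ofReal (ρ ^ 2) * ∫⁻ w in D, ENNReal.ofReal (‖g w - h w‖ ^ 2) ∂dA := by
    rw [← lintegral_const_mul' _ _ ENNReal.ofReal_ne_top,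
      ← lintegral_const_mul' _ _ ENNReal.ofReal_ne_top, ← lintegral_add_right' _ hmeas]
    exact setLIntegral_mono' Metric.isOpen_ball.measurableSet hpt
  calc ENNReal.ofReal (c ^ 2 / 2 * ‖b‖ ^ 2) * F
      ≤ ENNReal.ofReal (c ^ 2 / 2 * ‖b‖ ^ 2) * localMeanE t δ (fun w => g w - H w) α := by gcongr
    _ = (ENNReal.ofReal ((δ * t α) ^ 2))⁻¹ * (ENNReal.ofReal (c ^ 2 / 2 * ‖b‖ ^ 2) *
        ∫⁻ w in D, ENNReal.ofReal (‖g w - H w‖ ^ 2) ∂dA) := by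
        unfold localMeanE; rw [mul_left_comm]
    _ ≤ (ENNReal.ofReal ((δ * t α) ^ 2))⁻¹ *
        (∫⁻ w in D, ENNReal.ofReal (e w ^ 2 * ‖g w * (b * f w + r w) - U w‖ ^ 2) ∂dA +
        ENNReal.ofReal (ρ ^ 2) * ∫⁻ w in D, ENNReal.ofReal (‖g w - h w‖ ^ 2) ∂dA) := by gcongr
    _ = (ENNReal.ofReal ((δ * t α) ^ 2))⁻¹ *
        ∫⁻ w in D, ENNReal.ofReal (e w ^ 2 * ‖g w * (b * f w + r w) - U w‖ ^ 2) ∂dA +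
        ENNReal.ofReal (ρ ^ 2) * localMeanE t δ (fun w => g w - h w) α := by
        unfold localMeanE; rw [mul_add, mul_left_comm _ (ENNReal.ofReal (ρ ^ 2))]
    _ ≤ (ENNReal.ofReal ((δ * t α) ^ 2))⁻¹ *
        ∫⁻ w in D, ENNReal.ofReal (e w ^ 2 * ‖g w * (b * f w + r w) - U w‖ ^ 2) ∂dA +
        ENNReal.ofReal (ρ ^ 2) * (2 * F) := by gcongr
    _ = _ := by
        congr 1
        rw [← mul_assoc, ENNReal.ofReal_mul (by norm_num : (0 : ℝ) ≤ 2), mul_comm (ENNReal.ofReal 2)]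
        simp

lemma hk_ae_omega {ω φ : ℂ → ℝ} {τ : ℝ → ℝ} (hW : IsClassW ω φ τ) :
    AEMeasurable (fun z => ENNReal.ofReal (ω z)) (dA.restrict unitDisc) := by
  refine AEMeasurable.ennreal_ofReal ?_
  have h1 : ContinuousOn ω unitDisc := by
    have : ContinuousOn (fun z => Real.exp (-(2 * φ z))) unitDisc :=
      (hW.smooth.continuousOn.const_mul 2 |>.neg).rexp
    exact this.congr fun z hz => hW.omega_eq z hz
  exact h1.aemeasurable hk_isOpen_disc.measurableSet

lemma hk_lint {ω φ : ℂ → ℝ} {τ : ℝ → ℝ} (hW : IsClassW ω φ τ) (u : ℂ → ℂ) {D : Set ℂ}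
    (hD : MeasurableSet D) (hDs : D ⊆ unitDisc) :
    ∫⁻ w in D, ENNReal.ofReal (‖u w‖ ^ 2) ∂(muW ω) =
      ∫⁻ w in D, ENNReal.ofReal (Real.exp (-φ w) ^ 2 * ‖u w‖ ^ 2) ∂dA := by
  unfold muW
  rw [setLIntegral_withDensity_eq_setLIntegral_mul_non_measurable₀ _
    (hk_ae_omega hW).restrict _ hD (Eventually.of_forall fun _ => ENNReal.ofReal_lt_top),
    Measure.restrict_restrict hD, Set.inter_eq_left.2 hDs]
  refine setLIntegral_congr_fun hD fun w hw => ?_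
  simp only [Pi.mul_apply]
  rw [← ENNReal.ofReal_mul (hW.pos w (hDs hw)).le, hW.omega_eq w (hDs hw), ← Real.exp_nat_mul]
  congr 3; push_cast; ring_nf

lemma hk_muW_univ (ω : ℂ → ℝ) : muW ω = (muW ω).restrict unitDisc := by
  unfold muW
  rw [restrict_withDensity hk_isOpen_disc.measurableSet, Measure.restrict_restrict
    hk_isOpen_disc.measurableSet, Set.inter_self]

lemma hk_ac {ω φ : ℂ → ℝ} {τ : ℝ → ℝ} (hW : IsClassW ω φ τ) :
    dA.restrict unitDisc ≪ muW ω := by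
  unfold muW
  refine withDensity_absolutelyContinuous' (hk_ae_omega hW) ?_
  refine (ae_restrict_iff' hk_isOpen_disc.measurableSet).2 (Eventually.of_forall fun z hz => ?_)
  simpa using hW.pos z hz

lemma hk_norm_sq {ω : ℂ → ℝ} (v : Lp ℂ 2 (muW ω)) :
    ENNReal.ofReal (‖v‖ ^ 2) = ∫⁻ w, ENNReal.ofReal (‖(v : ℂ → ℂ) w‖ ^ 2) ∂(muW ω) := by
  rw [Lp.norm_def, eLpNorm_eq_lintegral_rpow_enorm_toReal (by norm_num) (by norm_num)]
  have h := Lp.eLpNorm_ne_top v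
  rw [eLpNorm_eq_lintegral_rpow_enorm_toReal (by norm_num) (by norm_num)] at h
  rw [← ENNReal.toReal_pow, ENNReal.ofReal_toReal (ENNReal.pow_ne_top h)]
  rw [← ENNReal.rpow_natCast, ← ENNReal.rpow_mul]
  simp only [ENNReal.toReal_ofNat, Nat.cast_ofNat]
  norm_num

lemma hk_F_finite {ω φ : ℂ → ℝ} {τ : ℝ → ℝ} {c₁ c₂ : ℝ} (hW : IsClassW ω φ τ)
    (hL : IsClassL (radialize τ) c₁ c₂) {δ : ℝ} (hδ : 0 < δ) (hδc : δ * c₁ ≤ 1 / 4)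
    {g : ℂ → ℂ} (hg : MemLp g 2 (muW ω)) {α : ℂ} (hα : α ∈ unitDisc) :
    FdeltaSqE (radialize τ) δ g α ≠ ⊤ := by
  set t := radialize τ
  have ht := hL.pos α hα
  set D := Metric.ball α (δ * t α) with hD
  have hα' := hk_mem_disc.1 hα
  have hcl : Metric.closedBall α (δ * t α) ⊆ unitDisc := by
    intro w hw
    rw [Metric.mem_closedBall, dist_eq_norm] at hw
    rw [hk_mem_disc]
    have h1 := hL.upper α hα
    have h2 : δ * t α ≤ δ * (c₁ * (1 - ‖α‖)) := by gcongr
    have h3 : ‖w‖ ≤ ‖w - α‖ + ‖α‖ := by simpa using norm_add_le (w - α) α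
    nlinarith
  have hDs : D ⊆ unitDisc := Metric.ball_subset_closedBall.trans hcl
  obtain ⟨B, hB⟩ := (isCompact_closedBall α (δ * t α)).exists_bound_of_continuousOn
    (hW.smooth.continuousOn.mono hcl)
  refine ne_top_of_le_ne_top ?_ (iInf₂_le (0 : ℂ → ℂ) (differentiableOn_const 0))
  unfold localMeanE
  have hpos : 0 < (δ * t α) ^ 2 := by positivity
  refine ENNReal.mul_ne_top (ENNReal.inv_ne_top.2 (by simpa using hpos.ne')) ?_
  have hfin : ∫⁻ w, ENNReal.ofReal (‖g w‖ ^ 2) ∂(muW ω) ≠ ⊤ := by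
    have h := hg.2.ne
    rw [eLpNorm_eq_lintegral_rpow_enorm_toReal (by norm_num) (by norm_num)] at h
    intro hcon
    apply h
    have : ∫⁻ w, ‖g w‖ₑ ^ (2 : ℝ≥0∞).toReal ∂(muW ω) = ⊤ := by
      rw [← hcon]
      refine lintegral_congr fun w => ?_
      rw [ENNReal.ofReal_pow (norm_nonneg _), ofReal_norm]
      norm_num
    rw [this]
    exact ENNReal.top_rpow_of_pos (by norm_num)
  have h1 : ∫⁻ w in D, ENNReal.ofReal (‖g w‖ ^ 2) ∂dA ≤ ENNReal.ofReal (Real.exp (2 * B)) *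
      ∫⁻ w, ENNReal.ofReal (‖g w‖ ^ 2) ∂(muW ω) := by
    calc _ ≤ ∫⁻ w in D, ENNReal.ofReal (Real.exp (2 * B)) *
          ENNReal.ofReal (Real.exp (-φ w) ^ 2 * ‖g w‖ ^ 2) ∂dA := by
          refine setLIntegral_mono' Metric.isOpen_ball.measurableSet fun w hw => ?_
          rw [← ENNReal.ofReal_mul (Real.exp_pos _).le]
          apply ENNReal.ofReal_le_ofReal
          rw [← mul_assoc]
          refine le_mul_of_one_le_left (by positivity) ?_
          rw [← Real.exp_nat_mul, ← Real.exp_add]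
          apply Real.one_le_exp
          have := hB w (Metric.ball_subset_closedBall hw)
          rw [Real.norm_eq_abs] at this
          have := (abs_le.1 this).2
          push_cast; linarith
      _ = ENNReal.ofReal (Real.exp (2 * B)) * ∫⁻ w in D, ENNReal.ofReal (‖g w‖ ^ 2) ∂(muW ω) := by
          rw [lintegral_const_mul' _ _ ENNReal.ofReal_ne_top,
            hk_lint hW g Metric.isOpen_ball.measurableSet hDs]
      _ ≤ _ := by gcongr; exact Measure.restrict_le_self
  have h2 : ∫⁻ w in D, ENNReal.ofReal (‖g w - (0 : ℂ → ℂ) w‖ ^ 2) ∂dA =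
      ∫⁻ w in D, ENNReal.ofReal (‖g w‖ ^ 2) ∂dA := by simp
  rw [h2]
  exact ne_top_of_le_ne_top (ENNReal.mul_ne_top ENNReal.ofReal_ne_top hfin) h1

lemma hk_finite_muW {ω φ : ℂ → ℝ} {τ : ℝ → ℝ} (hW : IsClassW ω φ τ) :
    IsFiniteMeasure (muW ω) := by
  refine ⟨?_⟩
  unfold muW
  rw [withDensity_apply _ MeasurableSet.univ, Measure.restrict_univ]
  exact hW.integrable

lemma hk_ae_disc (ω : ℂ → ℝ) : ∀ᵐ w ∂(muW ω), w ∈ unitDisc := by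
  rw [hk_muW_univ]
  exact ae_restrict_mem hk_isOpen_disc.measurableSet

lemma hk_bdd {F : ℂ → ℂ} (hF : Differentiable ℂ F) : ∃ M : ℝ, ∀ w ∈ unitDisc, ‖F w‖ ≤ M := by
  obtain ⟨M, hM⟩ := (isCompact_closedBall (0 : ℂ) 1).exists_bound_of_continuousOn
    hF.continuous.continuousOn
  exact ⟨M, fun w hw => hM w (Metric.ball_subset_closedBall hw)⟩

lemma hk_exists_v {ω φ : ℂ → ℝ} {τ : ℝ → ℝ} (hW : IsClassW ω φ τ) {F : ℂ → ℂ}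
    (hF : Differentiable ℂ F) :
    ∃ v : bergmanH ω, ((v : Lp ℂ 2 (muW ω)) : ℂ → ℂ) =ᵐ[muW ω] F := by
  have := hk_finite_muW hW
  obtain ⟨M, hM⟩ := hk_bdd hF
  have hm : MemLp F 2 (muW ω) := by
    refine MemLp.of_bound hF.continuous.aestronglyMeasurable M ?_
    filter_upwards [hk_ae_disc ω] with w hw using hM w hw
  refine ⟨⟨hm.toLp F, Submodule.le_topologicalClosure _ ⟨F, hF.differentiableOn, hm.coeFn_toLp⟩⟩,
    hm.coeFn_toLp⟩

lemma hk_sum_ae {ω : ℂ → ℝ} (S : Finset ℕ) (v : ℕ → bergmanH ω) (f : ℕ → ℂ → ℂ)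
    (hv : ∀ k, ((v k : Lp ℂ 2 (muW ω)) : ℂ → ℂ) =ᵐ[muW ω] f k) (a : ℕ → ℂ) :
    (((∑ k ∈ S, a k • v k : bergmanH ω) : Lp ℂ 2 (muW ω)) : ℂ → ℂ) =ᵐ[muW ω]
      fun w => ∑ k ∈ S, a k * f k w := by
  classical
  induction S using Finset.induction_on with
  | empty =>
    simp only [Finset.sum_empty]
    exact Lp.coeFn_zero ℂ 2 (muW ω)
  | insert i S hi ih =>
    rw [Finset.sum_insert hi]
    filter_upwards [ih, hv i, Lp.coeFn_smul (a i) (v i : Lp ℂ 2 (muW ω)),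
      Lp.coeFn_add (a i • (v i : Lp ℂ 2 (muW ω)))
        ((∑ k ∈ S, a k • v k : bergmanH ω) : Lp ℂ 2 (muW ω))] with w h1 h2 h3 h4
    rw [Finset.sum_insert hi, Submodule.coe_add, Submodule.coe_smul, h4, Pi.add_apply, h3,
      Pi.smul_apply, h2, h1, smul_eq_mul]

lemma hk_up {ω φ : ℂ → ℝ} {τ : ℝ → ℝ} {c₁ c₂ : ℝ} (hW : IsClassW ω φ τ)
    (hL : IsClassL (radialize τ) c₁ c₂) {δ : ℝ} (hδ : 0 < δ)
    (hδ1 : δ ≤ 1 / 4) (hδ2 : δ * c₂ ≤ 1 / 4) (z : ℕ → ℂ) (hz : ∀ j, z j ∈ unitDisc)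
    (hsep : ∀ j k, j ≠ k → δ * radialize τ (z k) ≤ ‖z j - z k‖) (S : Finset ℕ)
    (C : ℝ) (hC : 0 < C) (f : ℕ → ℂ → ℂ)
    (hf : ∀ k ∈ S, ∀ w ∈ unitDisc, ‖f k w‖ * Real.exp (-φ w) ≤ C * hkE (radialize τ) (z k) w)
    (v : ℕ → bergmanH ω)
    (hv : ∀ k, ((v k : Lp ℂ 2 (muW ω)) : ℂ → ℂ) =ᵐ[muW ω]
      fun w => ((radialize τ (z k) : ℝ) : ℂ)⁻¹ * f k w) (a : ℕ → ℂ) :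
    ‖∑ k ∈ S, a k • v k‖ ^ 2 ≤
      (C ^ 2 * ((1 + c₂) ^ 3 * (32 * hkI / (Real.pi * δ ^ 2))) * hkI + 1) *
        ∑ k ∈ S, ‖a k‖ ^ 2 := by
  set t := radialize τ
  set Row := (1 + c₂) ^ 3 * (32 * hkI / (Real.pi * δ ^ 2)) with hRow
  have hc := hL.c₂_pos
  have hI := hkI_nonneg
  have hRow0 : 0 ≤ Row := by positivity
  have ht : ∀ k, 0 < t (z k) := fun k => hL.pos _ (hz k)
  set u := ∑ k ∈ S, a k • v k with hu
  have hue := hk_sum_ae S v _ hv a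
  rw [← hu] at hue
  set Q : ℂ → ℝ := fun w => ∑ k ∈ S, (C ^ 2 * Row * (‖a k‖ / t (z k)) ^ 2) *
    (1 / (1 + ‖w - z k‖ / t (z k)) ^ 3) with hQ
  have hQ0 : ∀ w, 0 ≤ Q w := fun w => Finset.sum_nonneg fun k _ => by
    have := ht k; positivity
  have hQi : Integrable Q := by
    refine integrable_finsetSum _ fun k _ => ?_
    exact (hk_kern_integrable (z k) _ (ht k)).const_mul _
  have hQint : ∫ w, Q w = C ^ 2 * Row * hkI * ∑ k ∈ S, ‖a k‖ ^ 2 := by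
    rw [hQ, integral_finsetSum _ fun k _ => (hk_kern_integrable (z k) _ (ht k)).const_mul _,
      Finset.mul_sum]
    refine Finset.sum_congr rfl fun k _ => ?_
    rw [integral_const_mul, hk_kern_integral _ _ (ht k)]
    have := ht k
    field_simp
  have hpt : ∀ w ∈ unitDisc, Real.exp (-φ w) ^ 2 *
      ‖∑ k ∈ S, a k * (((t (z k) : ℝ) : ℂ)⁻¹ * f k w)‖ ^ 2 ≤ Q w := by
    intro w hw
    have htw := hL.pos w hw
    have hE : ∀ k, 0 ≤ hkE t (z k) w := fun k => hkE_nonneg (ht k) htw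
    have h1 : Real.exp (-φ w) * ‖∑ k ∈ S, a k * (((t (z k) : ℝ) : ℂ)⁻¹ * f k w)‖ ≤
        C * ∑ k ∈ S, ‖a k‖ / t (z k) * hkE t (z k) w := by
      calc _ ≤ Real.exp (-φ w) * ∑ k ∈ S, ‖a k * (((t (z k) : ℝ) : ℂ)⁻¹ * f k w)‖ := by
            gcongr; exact norm_sum_le _ _
        _ = ∑ k ∈ S, ‖a k‖ / t (z k) * (‖f k w‖ * Real.exp (-φ w)) := by
            rw [Finset.mul_sum]
            refine Finset.sum_congr rfl fun k _ => ?_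
            rw [norm_mul, norm_mul, norm_inv, Complex.norm_real, Real.norm_eq_abs,
              abs_of_pos (ht k)]
            ring
        _ ≤ ∑ k ∈ S, ‖a k‖ / t (z k) * (C * hkE t (z k) w) := by
            refine Finset.sum_le_sum fun k hk => ?_
            have := ht k
            exact mul_le_mul_of_nonneg_left (hf k hk w hw) (by positivity)
        _ = _ := by
            rw [Finset.mul_sum]
            refine Finset.sum_congr rfl fun k _ => ?_
            ring
    have h2 := hk_cs S (fun k => hkE t (z k) w) (fun k => ‖a k‖ / t (z k)) (fun k _ => hE k)
    have h3 := hkE_row hL hδ hδ1 hδ2 z hz hsep S w hw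
    have h4 : 0 ≤ ∑ k ∈ S, (‖a k‖ / t (z k)) ^ 2 * hkE t (z k) w :=
      Finset.sum_nonneg fun k _ => mul_nonneg (sq_nonneg _) (hE k)
    calc _ = (Real.exp (-φ w) * ‖∑ k ∈ S, a k * (((t (z k) : ℝ) : ℂ)⁻¹ * f k w)‖) ^ 2 := by ring
      _ ≤ (C * ∑ k ∈ S, ‖a k‖ / t (z k) * hkE t (z k) w) ^ 2 := by gcongr
      _ = C ^ 2 * (∑ k ∈ S, ‖a k‖ / t (z k) * hkE t (z k) w) ^ 2 := by ring
      _ ≤ C ^ 2 * (Row * ∑ k ∈ S, (‖a k‖ / t (z k)) ^ 2 * hkE t (z k) w) := by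
          gcongr
          exact h2.trans (mul_le_mul_of_nonneg_right h3 h4)
      _ = ∑ k ∈ S, (C ^ 2 * Row * (‖a k‖ / t (z k)) ^ 2) * hkE t (z k) w := by
          rw [← mul_assoc, Finset.mul_sum]
          refine Finset.sum_congr rfl fun k _ => ?_
          ring
      _ ≤ Q w := by
          refine Finset.sum_le_sum fun k _ => ?_
          have := ht k
          gcongr
          exact hkE_le_kern (ht k)
  have hmain : ENNReal.ofReal (‖u‖ ^ 2) ≤
      ENNReal.ofReal (C ^ 2 * Row * hkI * ∑ k ∈ S, ‖a k‖ ^ 2) := by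
    have e1 : ‖u‖ = ‖(u : Lp ℂ 2 (muW ω))‖ := rfl
    rw [e1, hk_norm_sq, ← hQint]
    calc _ = ∫⁻ w in unitDisc,
          ENNReal.ofReal (‖∑ k ∈ S, a k * (((t (z k) : ℝ) : ℂ)⁻¹ * f k w)‖ ^ 2) ∂(muW ω) := by
          rw [← hk_muW_univ]
          refine lintegral_congr_ae ?_
          filter_upwards [hue] with w hw
          rw [hw]
      _ = _ := hk_lint hW _ hk_isOpen_disc.measurableSet subset_rfl
      _ ≤ ∫⁻ w in unitDisc, ENNReal.ofReal (Q w) ∂dA :=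
          setLIntegral_mono' hk_isOpen_disc.measurableSet fun w hw =>
            ENNReal.ofReal_le_ofReal (hpt w hw)
      _ ≤ ∫⁻ w, ENNReal.ofReal (Q w) ∂dA := lintegral_mono' Measure.restrict_le_self le_rfl
      _ = (ENNReal.ofReal Real.pi)⁻¹ * ∫⁻ w, ENNReal.ofReal (Q w) := by
          unfold dA; rw [lintegral_smul_measure]; rfl
      _ ≤ 1 * ∫⁻ w, ENNReal.ofReal (Q w) := by
          gcongr
          rw [ENNReal.inv_le_one]
          simpa using (by linarith [Real.pi_gt_three] : (1 : ℝ) ≤ Real.pi)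
      _ = _ := by
          rw [one_mul, ofReal_integral_eq_lintegral_ofReal hQi (Eventually.of_forall hQ0)]
  have hs : 0 ≤ ∑ k ∈ S, ‖a k‖ ^ 2 := Finset.sum_nonneg fun _ _ => by positivity
  have := (ENNReal.ofReal_le_ofReal_iff (by positivity)).1 hmain
  linarith

lemma hk_low_aux {ω φ : ℂ → ℝ} {τ : ℝ → ℝ} {c₁ c₂ : ℝ} (hW : IsClassW ω φ τ)
    (hL : IsClassL (radialize τ) c₁ c₂) {δ : ℝ} (hδ : 0 < δ)
    (hδ1 : δ ≤ 1 / 4) (hδc1 : δ * c₁ ≤ 1 / 4) (hδ2 : δ * c₂ ≤ 1 / 4)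
    (g : ℂ → ℂ) (hg : MemLp g 2 (muW ω)) (z : ℕ → ℂ) (hz : ∀ j, z j ∈ unitDisc)
    (S : Finset ℕ)
    (C c : ℝ) (hC : 0 < C) (hc : 0 < c) (f : ℕ → ℂ → ℂ) (hfd : ∀ k, Differentiable ℂ (f k))
    (hf : ∀ k ∈ S, ∀ w ∈ unitDisc, ‖f k w‖ * Real.exp (-φ w) ≤ C * hkE (radialize τ) (z k) w)
    (hfc : ∀ k ∈ S, ∀ w, ‖w - z k‖ < δ * radialize τ (z k) → c ≤ ‖f k w‖ * Real.exp (-φ w))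
    (a : ℕ → ℂ) (U : ℂ → ℂ) (hU : DifferentiableOn ℂ U unitDisc)
    (q : ℝ) (hq : 0 < q) (hqF : ∀ j ∈ S, q ≤ (FdeltaSqE (radialize τ) δ g (z j)).toReal)
    (j : ℕ) (hj : j ∈ S) (x : ℝ) (hx0 : 0 ≤ x)
    (hx : ∫⁻ w in Metric.ball (z j) (δ * radialize τ (z j)),
      ENNReal.ofReal (‖g w * (∑ k ∈ S, a k * (((radialize τ (z k) : ℝ) : ℂ)⁻¹ * f k w)) - U w‖ ^ 2)
        ∂(muW ω) = ENNReal.ofReal x) :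
    (c ^ 2 / 2 * ‖a j‖ ^ 2 - 2 * ((32 * C) ^ 2 * (radialize τ (z j) ^ 2 *
      (∑ k ∈ S.erase j, ‖a k‖ / radialize τ (z k) *
        hkE (radialize τ) (z k) (z j)) ^ 2))) * δ ^ 2 * q ≤ x := by
  set t := radialize τ
  have ht : ∀ k, 0 < t (z k) := fun k => hL.pos _ (hz k)
  set D := Metric.ball (z j) (δ * t (z j)) with hD
  have hDs : D ⊆ unitDisc := fun w hw => hk_disc_sub hL hδc1 (hz j)
    (by rwa [hD, Metric.mem_ball, dist_eq_norm] at hw) hδ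
  have hE : ∀ k, 0 ≤ hkE t (z k) (z j) := fun k => hkE_nonneg (ht k) (ht j)
  set Sg := ∑ k ∈ S.erase j, ‖a k‖ / t (z k) * hkE t (z k) (z j) with hSg
  set F := FdeltaSqE t δ g (z j) with hF
  have hF1 : F ≠ ⊤ := hk_F_finite hW hL hδ hδc1 hg (hz j)
  have hqj : q ≤ F.toReal := hqF j hj
  have hF0 : F ≠ 0 := by
    intro h; rw [h] at hqj; simp at hqj; linarith
  set b : ℂ := a j * ((t (z j) : ℝ) : ℂ)⁻¹ with hb
  set r : ℂ → ℂ := fun w => ∑ k ∈ S.erase j, a k * (((t (z k) : ℝ) : ℂ)⁻¹ * f k w) with hr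
  have hrd : Differentiable ℂ r := by
    have : r = ∑ k ∈ S.erase j, fun w => a k * (((t (z k) : ℝ) : ℂ)⁻¹ * f k w) := by
      funext w; simp [hr]
    rw [this]
    exact Differentiable.sum fun k _ => ((hfd k).const_mul _).const_mul _
  have hrρ : ∀ w ∈ D, ‖r w‖ * Real.exp (-φ w) ≤ 32 * C * Sg := by
    intro w hw
    calc _ ≤ (∑ k ∈ S.erase j, ‖a k * (((t (z k) : ℝ) : ℂ)⁻¹ * f k w)‖) * Real.exp (-φ w) := by
          gcongr; exact norm_sum_le _ _
      _ = ∑ k ∈ S.erase j, ‖a k‖ / t (z k) * (‖f k w‖ * Real.exp (-φ w)) := by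
          rw [Finset.sum_mul]
          refine Finset.sum_congr rfl fun k _ => ?_
          rw [norm_mul, norm_mul, norm_inv, Complex.norm_real, Real.norm_eq_abs,
            abs_of_pos (ht k)]
          ring
      _ ≤ ∑ k ∈ S.erase j, ‖a k‖ / t (z k) * (C * (32 * hkE t (z k) (z j))) := by
          refine Finset.sum_le_sum fun k hk => ?_
          have := ht k
          refine mul_le_mul_of_nonneg_left ?_ (by positivity)
          refine (hf k (Finset.mem_of_mem_erase hk) w (hDs hw)).trans ?_
          refine mul_le_mul_of_nonneg_left ?_ hC.le
          refine hkE_stab hL hδ hδ1 hδ2 (hz k) (hz j) (hDs hw) ?_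
          rwa [hD, Metric.mem_ball, dist_eq_norm] at hw
      _ = _ := by
          rw [hSg, Finset.mul_sum]
          refine Finset.sum_congr rfl fun k _ => ?_
          ring
  have hgm : AEMeasurable g (dA.restrict D) := by
    have h1 : AEMeasurable g (dA.restrict unitDisc) :=
      hg.1.aemeasurable.mono_ac (hk_ac hW)
    exact h1.mono_measure (Measure.restrict_mono hDs le_rfl)
  have hloc := hk_local (t := t) (δ := δ) (g := g) (f := f j) (r := r) (U := U)
    (e := fun w => Real.exp (-φ w)) (α := z j) (b := b) (c := c) (ρ := 32 * C * Sg) hc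
    (fun w => (Real.exp_pos _).le) (hfd j).differentiableOn hrd.differentiableOn (hU.mono hDs)
    (fun w hw => hfc j hj w (by rwa [Metric.mem_ball, dist_eq_norm] at hw))
    hrρ hgm hF0 hF1
  have hbf : ∀ w, b * f j w + r w = ∑ k ∈ S, a k * (((t (z k) : ℝ) : ℂ)⁻¹ * f k w) := by
    intro w
    rw [← Finset.add_sum_erase S _ hj, hb, mul_assoc]
  simp only [hbf] at hloc
  rw [hk_lint hW _ Metric.isOpen_ball.measurableSet hDs] at hx
  rw [hx, ← hF] at hloc
  have hFr : F = ENNReal.ofReal F.toReal := (ENNReal.ofReal_toReal hF1).symm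
  have htj := ht j
  rw [hFr, ← ENNReal.ofReal_inv_of_pos (by positivity), ← ENNReal.ofReal_mul (by positivity),
    ← ENNReal.ofReal_mul (by positivity), ← ENNReal.ofReal_mul (by positivity),
    ← ENNReal.ofReal_add (by positivity) (by positivity),
    ENNReal.ofReal_le_ofReal_iff (by positivity)] at hloc
  have hbn : ‖b‖ = ‖a j‖ / t (z j) := by
    rw [hb, norm_mul, norm_inv, Complex.norm_real, Real.norm_eq_abs, abs_of_pos htj]; rfl
  rw [hbn] at hloc
  set Y := F.toReal
  have h2 : (c ^ 2 / 2 * ‖a j‖ ^ 2 - 2 * ((32 * C) ^ 2 * (t (z j) ^ 2 * Sg ^ 2))) * δ ^ 2 * Y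
      ≤ x := by
    have h3 := mul_le_mul_of_nonneg_left hloc (by positivity : 0 ≤ (δ * t (z j)) ^ 2)
    have h4 : (δ * t (z j)) ^ 2 * (c ^ 2 / 2 * (‖a j‖ / t (z j)) ^ 2 * Y) =
        c ^ 2 / 2 * ‖a j‖ ^ 2 * δ ^ 2 * Y := by field_simp
    have h5 : (δ * t (z j)) ^ 2 * (((δ * t (z j)) ^ 2)⁻¹ * x +
        2 * (32 * C * Sg) ^ 2 * Y) = x + 2 * ((32 * C) ^ 2 * (t (z j) ^ 2 * Sg ^ 2)) * δ ^ 2 * Y := by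
      field_simp
    rw [h4, h5] at h3
    linarith
  set A := (c ^ 2 / 2 * ‖a j‖ ^ 2 - 2 * ((32 * C) ^ 2 * (t (z j) ^ 2 * Sg ^ 2))) * δ ^ 2
  by_cases hA : 0 ≤ A
  · exact (mul_le_mul_of_nonneg_left hqj hA).trans h2
  · push Not at hA
    nlinarith

lemma hk_low {ω φ : ℂ → ℝ} {τ : ℝ → ℝ} {c₁ c₂ : ℝ} (hW : IsClassW ω φ τ)
    (hL : IsClassL (radialize τ) c₁ c₂) {δ : ℝ} (hδ : 0 < δ)
    (hδ1 : δ ≤ 1 / 4) (hδc1 : δ * c₁ ≤ 1 / 4) (hδ2 : δ * c₂ ≤ 1 / 4)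
    (g : ℂ → ℂ) (hg : MemLp g 2 (muW ω))
    (T : bergmanH ω →L[ℂ] Lp ℂ 2 (muW ω)) (hT : IsHankelExtension ω g T)
    (z : ℕ → ℂ) (hz : ∀ j, z j ∈ unitDisc)
    (hsep : ∀ j k, j ≠ k → δ * radialize τ (z k) ≤ ‖z j - z k‖)
    (S : Finset ℕ)
    (C c : ℝ) (hC : 0 < C) (hc : 0 < c) (f : ℕ → ℂ → ℂ) (hfd : ∀ k, Differentiable ℂ (f k))
    (hf : ∀ k ∈ S, ∀ w ∈ unitDisc, ‖f k w‖ * Real.exp (-φ w) ≤ C * hkE (radialize τ) (z k) w)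
    (hfc : ∀ k ∈ S, ∀ w, ‖w - z k‖ < δ * radialize τ (z k) → c ≤ ‖f k w‖ * Real.exp (-φ w))
    (v : ℕ → bergmanH ω)
    (hv : ∀ k, ((v k : Lp ℂ 2 (muW ω)) : ℂ → ℂ) =ᵐ[muW ω]
      fun w => ((radialize τ (z k) : ℝ) : ℂ)⁻¹ * f k w)
    (R : ℝ) (hR : 1 ≤ R)
    (hRK : (32 * C) ^ 2 * ((1 + c₂) ^ 3 * (32 * hkI / (Real.pi * δ ^ 2)) *
      ((32 * hkI / (Real.pi * δ ^ 2)) / R)) ≤ c ^ 2 / 8)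
    (hRsep : ∀ j ∈ S, ∀ k ∈ S, j ≠ k →
      R * min (radialize τ (z j)) (radialize τ (z k)) ≤ ‖z j - z k‖)
    (q : ℝ) (hq : 0 < q) (hqF : ∀ j ∈ S, q ≤ (FdeltaSqE (radialize τ) δ g (z j)).toReal)
    (a : ℕ → ℂ) :
    (c ^ 2 / 4 * δ ^ 2 * q) * ∑ k ∈ S, ‖a k‖ ^ 2 ≤ ‖T (∑ k ∈ S, a k • v k)‖ ^ 2 := by
  set t := radialize τ
  set Fa : ℂ → ℂ := fun w => ∑ k ∈ S, a k * (((t (z k) : ℝ) : ℂ)⁻¹ * f k w) with hFa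
  have hFad : Differentiable ℂ Fa := by
    have : Fa = ∑ k ∈ S, fun w => a k * (((t (z k) : ℝ) : ℂ)⁻¹ * f k w) := by
      funext w; simp [hFa]
    rw [this]
    exact Differentiable.sum fun k _ => ((hfd k).const_mul _).const_mul _
  obtain ⟨M, hM⟩ := hk_bdd hFad
  have hgF : MemLp (fun w => g w * Fa w) 2 (muW ω) := by
    refine MemLp.of_le_mul (c := M) hg
      (hg.1.mul hFad.continuous.aestronglyMeasurable) ?_
    filter_upwards [hk_ae_disc ω] with w hw
    rw [norm_mul, mul_comm]
    gcongr
    exact hM w hw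
  rw [hT _ Fa M hFad.differentiableOn hM (hk_sum_ae S v _ hv a) (hgF.toLp _) hgF.coeFn_toLp]
  set gF := hgF.toLp _ with hgFdef
  have hclosed : IsClosed {v : Lp ℂ 2 (muW ω) |
      (c ^ 2 / 4 * δ ^ 2 * q) * ∑ k ∈ S, ‖a k‖ ^ 2 ≤ ‖gF - v‖ ^ 2} :=
    isClosed_le continuous_const (by fun_prop)
  have hmem : bergmanProj ω gF ∈ closure ((bergmanSubmodule ω : Submodule ℂ _) :
      Set (Lp ℂ 2 (muW ω))) := by
    have : bergmanProj ω gF ∈ bergmanH ω := by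
      unfold bergmanProj; exact (bergmanProjA ω gF).2
    unfold bergmanH at this
    rwa [← SetLike.mem_coe, Submodule.topologicalClosure_coe] at this
  refine closure_minimal (t := {v : Lp ℂ 2 (muW ω) |
      (c ^ 2 / 4 * δ ^ 2 * q) * ∑ k ∈ S, ‖a k‖ ^ 2 ≤ ‖gF - v‖ ^ 2}) ?_ hclosed hmem
  rintro u ⟨U, hU, hUe⟩
  show (c ^ 2 / 4 * δ ^ 2 * q) * ∑ k ∈ S, ‖a k‖ ^ 2 ≤ ‖gF - u‖ ^ 2
  set X : ℕ → ℝ≥0∞ := fun j => ∫⁻ w in Metric.ball (z j) (δ * t (z j)),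
      ENNReal.ofReal (‖g w * Fa w - U w‖ ^ 2) ∂(muW ω) with hX
  have htot : ENNReal.ofReal (‖gF - u‖ ^ 2) =
      ∫⁻ w, ENNReal.ofReal (‖g w * Fa w - U w‖ ^ 2) ∂(muW ω) := by
    rw [hk_norm_sq]
    refine lintegral_congr_ae ?_
    filter_upwards [Lp.coeFn_sub gF u, hgF.coeFn_toLp, hUe] with w h1 h2 h3
    rw [h1, Pi.sub_apply, h2, h3]
  have hsumX : ∑ j ∈ S, X j ≤ ENNReal.ofReal (‖gF - u‖ ^ 2) := by
    rw [htot, ← lintegral_biUnion_finset (fun j hj k hk hjk => hk_disj hL hδ hδ1 hδ2 (hz j) (hz k) hR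
      (hRsep j hj k hk hjk)) (fun j _ => Metric.isOpen_ball.measurableSet)]
    exact lintegral_mono' Measure.restrict_le_self le_rfl
  have hXfin : ∀ j ∈ S, X j ≠ ⊤ := fun j hj => ne_top_of_le_ne_top ENNReal.ofReal_ne_top
    ((Finset.single_le_sum (f := X) (fun _ _ => bot_le) hj).trans hsumX)
  have hj : ∀ j ∈ S, (c ^ 2 / 2 * ‖a j‖ ^ 2 - 2 * ((32 * C) ^ 2 * (t (z j) ^ 2 *
      (∑ k ∈ S.erase j, ‖a k‖ / t (z k) * hkE t (z k) (z j)) ^ 2))) * δ ^ 2 * q ≤ (X j).toReal :=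
    fun j hj => hk_low_aux hW hL hδ hδ1 hδc1 hδ2 g hg z hz S C c hC hc f hfd hf hfc a U hU q hq
      hqF j hj _ ENNReal.toReal_nonneg (ENNReal.ofReal_toReal (hXfin j hj)).symm
  have hsum2 : ∑ j ∈ S, (X j).toReal ≤ ‖gF - u‖ ^ 2 := by
    rw [← ENNReal.toReal_sum hXfin]
    exact ENNReal.toReal_le_of_le_ofReal (by positivity) hsumX
  refine le_trans ?_ hsum2
  refine le_trans ?_ (Finset.sum_le_sum hj)
  have hoff := hk_offdiag hL hδ hδ1 hδ2 z hz hsep S R (by linarith) hRsep (fun k => ‖a k‖)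
  set N := ∑ k ∈ S, ‖a k‖ ^ 2 with hN
  have hN0 : 0 ≤ N := Finset.sum_nonneg fun _ _ => by positivity
  rw [← Finset.sum_mul, ← Finset.sum_mul, Finset.sum_sub_distrib, ← Finset.mul_sum,
    ← Finset.mul_sum, ← Finset.mul_sum, ← hN]
  set O := ∑ j ∈ S, t (z j) ^ 2 * (∑ k ∈ S.erase j, ‖a k‖ / t (z k) * hkE t (z k) (z j)) ^ 2
  have h1 : (32 * C) ^ 2 * O ≤ c ^ 2 / 8 * N := by
    calc _ ≤ (32 * C) ^ 2 * _ := mul_le_mul_of_nonneg_left hoff (by positivity)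
      _ ≤ _ := by rw [← mul_assoc]; exact mul_le_mul_of_nonneg_right hRK hN0
  have h2 : c ^ 2 / 4 * N ≤ c ^ 2 / 2 * N - 2 * ((32 * C) ^ 2 * O) := by linarith
  calc c ^ 2 / 4 * δ ^ 2 * q * N = c ^ 2 / 4 * N * δ ^ 2 * q := by ring
    _ ≤ _ := by gcongr

lemma hk_op {ω φ : ℂ → ℝ} {τ : ℝ → ℝ} {c₁ c₂ : ℝ} (hW : IsClassW ω φ τ)
    (hL : IsClassL (radialize τ) c₁ c₂) {δ : ℝ} (hδ : 0 < δ)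
    (hδ1 : δ ≤ 1 / 32) (hδc1 : δ * c₁ ≤ 1 / 32) (hδ2 : δ * c₂ ≤ 1 / 32)
    (g : ℂ → ℂ) (hg : MemLp g 2 (muW ω))
    (T : bergmanH ω →L[ℂ] Lp ℂ 2 (muW ω)) (hT : IsHankelExtension ω g T) :
    ∃ r₁ < (1 : ℝ), ∃ R ≥ (1 : ℝ), ∃ c' > (0 : ℝ), ∀ z : ℕ → ℂ, (∀ j, z j ∈ unitDisc) →
      (∀ j k, j ≠ k → δ * radialize τ (z k) ≤ ‖z j - z k‖) →
      ∀ S : Finset ℕ, S.Nonempty → (∀ j ∈ S, r₁ ≤ ‖z j‖) →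
      (∀ j ∈ S, ∀ k ∈ S, j ≠ k →
        R * min (radialize τ (z j)) (radialize τ (z k)) ≤ ‖z j - z k‖) →
      ∃ j ∈ S, c' * Real.sqrt (FdeltaSqE (radialize τ) δ g (z j)).toReal ≤
        singularNumber T (S.card - 1) := by
  obtain ⟨r₁, hr1, C, hC, c, hc, htest⟩ := hk_test hW hL hδ hδ1 hδc1 hδ2
  have hc2 := hL.c₂_pos
  have hI := hkI_nonneg
  set G := 32 * hkI / (Real.pi * δ ^ 2) with hG
  have hG0 : 0 ≤ G := by positivity
  set R := 1 + 8 * ((32 * C) ^ 2 * ((1 + c₂) ^ 3 * G * G)) / c ^ 2 with hR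
  have hR1 : 1 ≤ R := by rw [hR]; simp; positivity
  have hRK : (32 * C) ^ 2 * ((1 + c₂) ^ 3 * G * (G / R)) ≤ c ^ 2 / 8 := by
    have : (32 * C) ^ 2 * ((1 + c₂) ^ 3 * G * (G / R)) =
      ((32 * C) ^ 2 * ((1 + c₂) ^ 3 * G * G)) / R := by ring
    rw [this, div_le_iff₀ (by linarith), hR]
    set K := (32 * C) ^ 2 * ((1 + c₂) ^ 3 * G * G)
    have : c ^ 2 / 8 * (1 + 8 * K / c ^ 2) = c ^ 2 / 8 + K := by field_simp
    rw [this]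
    have : 0 ≤ c ^ 2 / 8 := by positivity
    linarith
  set Cu := C ^ 2 * ((1 + c₂) ^ 3 * G) * hkI + 1 with hCu
  have hCu0 : 0 < Cu := by positivity
  refine ⟨r₁, hr1, R, hR1, Real.sqrt (c ^ 2 / 4 * δ ^ 2 / Cu),
    Real.sqrt_pos.2 (by positivity), ?_⟩
  intro z hz hsep S hS hSr hRsep
  obtain ⟨j, hj, hmin⟩ := S.exists_min_image
    (fun j => (FdeltaSqE (radialize τ) δ g (z j)).toReal) hS
  refine ⟨j, hj, ?_⟩
  set q := (FdeltaSqE (radialize τ) δ g (z j)).toReal with hq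
  have hq0 : 0 ≤ q := ENNReal.toReal_nonneg
  rcases hq0.eq_or_lt with h0 | h0
  · rw [← h0]
    simp only [Real.sqrt_zero, mul_zero]
    refine Real.sInf_nonneg ?_
    rintro _ ⟨K, _, rfl⟩
    exact norm_nonneg (T - K)
  have hex : ∀ k, ∃ f : ℂ → ℂ, Differentiable ℂ f ∧ (k ∈ S →
        (∀ w ∈ unitDisc, ‖f w‖ * Real.exp (-φ w) ≤ C * hkE (radialize τ) (z k) w) ∧
        (∀ w, ‖w - z k‖ < δ * radialize τ (z k) → c ≤ ‖f w‖ * Real.exp (-φ w))) := by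
    intro k
    by_cases hk : k ∈ S
    · obtain ⟨f, h1, h2, h3⟩ := htest (z k) (hz k) (hSr k hk)
      exact ⟨f, h1, fun _ => ⟨h2, h3⟩⟩
    · exact ⟨0, differentiable_const 0, fun h => absurd h hk⟩
  choose f hfd hf using hex
  have hexv : ∀ k, ∃ v : bergmanH ω, ((v : Lp ℂ 2 (muW ω)) : ℂ → ℂ) =ᵐ[muW ω]
      fun w => ((radialize τ (z k) : ℝ) : ℂ)⁻¹ * f k w :=
    fun k => hk_exists_v hW ((hfd k).const_mul _)
  choose v hv using hexv
  have h1 := hk_sing T S hS v Cu (c ^ 2 / 4 * δ ^ 2 * q) hCu0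
    (hk_up hW hL hδ (by linarith) (by linarith) z hz hsep S C hC f (fun k hk => (hf k hk).1) v hv)
    (hk_low hW hL hδ (by linarith) (by linarith) (by linarith) g hg T hT z hz hsep S C c hC hc f hfd
      (fun k hk => (hf k hk).1) (fun k hk => (hf k hk).2) v hv R hR1 hRK hRsep q h0 hmin)
  rw [← Real.sqrt_mul (by positivity)]
  convert h1 using 2
  ring

lemma hk_comb1 (F s : ℕ → ℝ) (hF : ∀ j, 0 ≤ F j) {c' p : ℝ} (hc : 0 < c')
    (hp : 0 < p) (S : Finset ℕ)
    (h : ∀ S' ⊆ S, S'.Nonempty → ∃ j ∈ S', c' * F j ≤ s (S'.card - 1)) :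
    ∑ j ∈ S, F j ^ p ≤ (c' ^ p)⁻¹ * ∑ ν ∈ Finset.range S.card, s ν ^ p := by
  induction S using Finset.strongInduction with
  | H S ih =>
    rcases S.eq_empty_or_nonempty with rfl | hne
    · simp
    obtain ⟨j, hj, hle⟩ := h S subset_rfl hne
    have h1 := ih (S.erase j) (Finset.erase_ssubset hj)
      (fun S' hS' => h S' (hS'.trans (Finset.erase_subset _ _)))
    rw [Finset.card_erase_of_mem hj] at h1
    have hcard : S.card = (S.card - 1) + 1 := by have := hne.card_pos; omega
    rw [hcard, Finset.sum_range_succ, mul_add, ← Finset.add_sum_erase S _ hj]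
    have h2 : F j ^ p ≤ (c' ^ p)⁻¹ * s (S.card - 1) ^ p := by
      rw [← div_eq_inv_mul, le_div_iff₀ (by positivity), mul_comm,
        ← Real.mul_rpow hc.le (hF j)]
      exact Real.rpow_le_rpow (mul_nonneg hc.le (hF j)) hle hp.le
    linarith

lemma hk_comb2 (W : ℕ → ℝ) (hW : ∀ j, 0 ≤ W j) (near : ℕ → ℕ → Prop) (hrefl : ∀ j, near j j)
    (hsymm : ∀ j k, near j k → near k j) (M : ℝ)
    (hcount : ∀ (j : ℕ) (K : Finset ℕ), (∀ k ∈ K, near k j) → (K.card : ℝ) ≤ M) (J : Finset ℕ) :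
    ∃ S ⊆ J, (∀ j ∈ S, ∀ k ∈ S, j ≠ k → ¬ near j k) ∧ ∑ j ∈ J, W j ≤ M * ∑ j ∈ S, W j := by
  classical
  induction J using Finset.strongInduction with
  | H J ih =>
    rcases J.eq_empty_or_nonempty with rfl | hne
    · exact ⟨∅, subset_rfl, by simp, by simp⟩
    obtain ⟨j, hj, hmax⟩ := J.exists_max_image W hne
    obtain ⟨S, hSJ, hS, hsum⟩ := ih (J.filter fun k => ¬ near k j)
      (Finset.filter_ssubset.2 ⟨j, hj, by simpa using hrefl j⟩)
    have hSnear : ∀ k ∈ S, ¬ near k j := fun k hk => (Finset.mem_filter.1 (hSJ hk)).2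
    have hjS : j ∉ S := fun h => hSnear j h (hrefl j)
    refine ⟨insert j S, ?_, ?_, ?_⟩
    · intro k hk
      rcases Finset.mem_insert.1 hk with rfl | hk
      · exact hj
      · exact (Finset.mem_filter.1 (hSJ hk)).1
    · intro a ha b hb hab
      rcases Finset.mem_insert.1 ha with ha1 | ha1 <;>
        rcases Finset.mem_insert.1 hb with hb1 | hb1
      · exact absurd (ha1.trans hb1.symm) hab
      · rw [ha1]; exact fun h => hSnear b hb1 (hsymm _ _ h)
      · rw [hb1]; exact hSnear a ha1
      · exact hS a ha1 b hb1 hab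
    · rw [Finset.sum_insert hjS, mul_add, ← Finset.sum_filter_add_sum_filter_not J (fun k => near k j)]
      have h1 : ∑ k ∈ J.filter (fun k => near k j), W k ≤ M * W j := by
        calc _ ≤ ∑ k ∈ J.filter (fun k => near k j), W j :=
              Finset.sum_le_sum fun k hk => hmax k (Finset.mem_filter.1 hk).1
          _ = ((J.filter (fun k => near k j)).card : ℝ) * W j := by
              rw [Finset.sum_const, nsmul_eq_mul]
          _ ≤ M * W j := by
              refine mul_le_mul_of_nonneg_right (hcount j _ ?_) (hW j)
              intro k hk; exact (Finset.mem_filter.1 hk).2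
      linarith

lemma hk_inner_finite {ω φ : ℂ → ℝ} {τ : ℝ → ℝ} {c₁ c₂ : ℝ} (hW : IsClassW ω φ τ)
    (hL : IsClassL (radialize τ) c₁ c₂) {δ : ℝ} (hδ : 0 < δ)
    (hδ1 : δ ≤ 1 / 4) (hδ2 : δ * c₂ ≤ 1 / 4)
    (z : ℕ → ℂ) (hz : ∀ j, z j ∈ unitDisc)
    (hsep : ∀ j k, j ≠ k → δ * radialize τ (z k) ≤ ‖z j - z k‖) {r₁ : ℝ} (hr : r₁ < 1) :
    {j | ‖z j‖ < r₁}.Finite := by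
  by_contra hinf
  have hinf : {j | ‖z j‖ < r₁}.Infinite := hinf
  obtain ⟨j₀, hj₀⟩ := hinf.nonempty
  have hr0 : 0 < r₁ := (norm_nonneg _).trans_lt hj₀
  have hm : 0 < τ r₁ := hW.tau_pos r₁ ⟨hr0.le, hr⟩
  set N := (32 * hkI / (Real.pi * δ ^ 2)) * ((1 + 1 / τ r₁) ^ 3 * (1 + c₂ * (1 / τ r₁)) ^ 2)
  obtain ⟨K, hK, hKc⟩ := hinf.exists_subset_card_eq (⌈N⌉₊ + 1)
  have h0 : (0 : ℂ) ∈ unitDisc := by rw [hk_mem_disc]; simp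
  have h1 := hk_count hL hδ hδ1 hδ2 z hz hsep K 0 h0 (1 / τ r₁) (by positivity) (by
    intro k hk
    have hk1 : ‖z k‖ < r₁ := hK hk
    have e1 : τ r₁ ≤ radialize τ (z k) :=
      hW.tau_anti ⟨norm_nonneg _, hk1.trans hr⟩ ⟨hr0.le, hr⟩ hk1.le
    have e2 : τ r₁ ≤ radialize τ 0 := by
      unfold radialize; rw [norm_zero]
      exact hW.tau_anti ⟨le_rfl, by norm_num⟩ ⟨hr0.le, hr⟩ hr0.le
    rw [sub_zero]
    calc ‖z k‖ ≤ 1 := (hk1.trans hr).le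
      _ = 1 / τ r₁ * τ r₁ := by field_simp
      _ ≤ _ := by gcongr; exact le_min e1 e2)
  rw [hKc] at h1
  have h2 := Nat.le_ceil N
  push_cast at h1
  have h3 : (⌈N⌉₊ : ℝ) + 1 ≤ N := h1
  linarith

theorem stmt1 (ω φ : ℂ → ℝ) (τ : ℝ → ℝ) (c₁ c₂ : ℝ)
    (hW : IsClassW ω φ τ) (hL : IsClassL (radialize τ) c₁ c₂)
    (g : ℂ → ℂ) (hg : MemLp g 2 (muW ω))
    (T : bergmanH ω →L[ℂ] Lp ℂ 2 (muW ω)) (hT : IsHankelExtension ω g T)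
    (p : ℝ) (hp : p ∈ Set.Ioo (0 : ℝ) 1)
    (hS : MemSchatten p T) :
    ∃ δ ∈ Set.Ioo 0 (mTau c₁ c₂), ∀ z : ℕ → ℂ, IsLattice (radialize τ) δ z →
      ∑' j : ℕ, (FdeltaSqE (radialize τ) δ g (z j)) ^ (p / 2) < ⊤ := by
  classical
  have hc1 := hL.c₁_pos
  have hc2 := hL.c₂_pos
  have hm0 : 0 < mTau c₁ c₂ := by unfold mTau; positivity
  have hm1 : mTau c₁ c₂ ≤ 1 / 4 := by
    unfold mTau; have := min_le_left 1 (min c₁⁻¹ c₂⁻¹); linarith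
  have hm2 : mTau c₁ c₂ * c₁ ≤ 1 / 4 := by
    unfold mTau
    have h := (min_le_right 1 (min c₁⁻¹ c₂⁻¹)).trans (min_le_left _ _)
    have h' := mul_le_mul_of_nonneg_right h hc1.le
    rw [inv_mul_cancel₀ hc1.ne'] at h'
    linarith
  have hm3 : mTau c₁ c₂ * c₂ ≤ 1 / 4 := by
    unfold mTau
    have h := (min_le_right 1 (min c₁⁻¹ c₂⁻¹)).trans (min_le_right _ _)
    have h' := mul_le_mul_of_nonneg_right h hc2.le
    rw [inv_mul_cancel₀ hc2.ne'] at h'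
    linarith
  set δ := mTau c₁ c₂ / 8 with hδdef
  have hδ : 0 < δ := by positivity
  have hδ1 : δ ≤ 1 / 32 := by linarith
  have hδc1 : δ * c₁ ≤ 1 / 32 := by rw [hδdef]; linarith
  have hδ2 : δ * c₂ ≤ 1 / 32 := by rw [hδdef]; linarith
  refine ⟨δ, ⟨hδ, by linarith⟩, fun z hlat => ?_⟩
  obtain ⟨r₁, hr1, R, hR, c', hc', hop⟩ := hk_op hW hL hδ hδ1 hδc1 hδ2 g hg T hT
  have hz := hlat.mem
  have hsep : ∀ j k, j ≠ k → δ * radialize τ (z k) ≤ ‖z j - z k‖ := by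
    intro j k hjk
    have := hlat.sep j k hjk
    rwa [Metric.mem_ball, not_lt, dist_eq_norm] at this
  have hop' := hop z hz hsep
  set t := radialize τ with ht
  set F : ℕ → ℝ := fun j => Real.sqrt (FdeltaSqE t δ g (z j)).toReal with hF
  have hF0 : ∀ j, 0 ≤ F j := fun j => Real.sqrt_nonneg _
  set W : ℕ → ℝ := fun j => F j ^ p with hWdef
  have hW0 : ∀ j, 0 ≤ W j := fun j => Real.rpow_nonneg (hF0 j) _
  have hFin : ∀ j, FdeltaSqE t δ g (z j) ≠ ⊤ := fun j =>
    hk_F_finite hW hL hδ (by linarith) hg (hz j)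
  have hEq : ∀ j, FdeltaSqE t δ g (z j) ^ (p / 2) = ENNReal.ofReal (W j) := by
    intro j
    have h1 : W j = (FdeltaSqE t δ g (z j)).toReal ^ (p / 2) := by
      simp only [hWdef, hF]
      rw [Real.sqrt_eq_rpow, ← Real.rpow_mul ENNReal.toReal_nonneg]
      congr 1; ring
    rw [h1, ← ENNReal.ofReal_rpow_of_nonneg ENNReal.toReal_nonneg (by linarith [hp.1]),
      ENNReal.ofReal_toReal (hFin j)]
  set near : ℕ → ℕ → Prop := fun k j => ‖z k - z j‖ ≤ R * min (t (z k)) (t (z j)) with hnear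
  have htp : ∀ k, 0 < t (z k) := fun k => hL.pos _ (hz k)
  set M := (32 * hkI / (Real.pi * δ ^ 2)) * ((1 + R) ^ 3 * (1 + c₂ * R) ^ 2) with hM
  have hM0 : 0 ≤ M := by have := hkI_nonneg; positivity
  set s : ℕ → ℝ := fun ν => singularNumber T ν with hs
  have hs0 : ∀ ν, 0 ≤ s ν := by
    intro ν
    refine Real.sInf_nonneg ?_
    rintro _ ⟨K, _, rfl⟩
    exact norm_nonneg (T - K)
  have hsum : Summable fun ν => s ν ^ p := hS
  set B := M * ((c' ^ p)⁻¹ * ∑' ν, s ν ^ p) with hB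
  have hbound : ∀ J : Finset ℕ, (∀ j ∈ J, r₁ ≤ ‖z j‖) → ∑ j ∈ J, W j ≤ B := by
    intro J hJ
    obtain ⟨S, hSJ, hSn, hle⟩ := hk_comb2 W hW0 near
      (fun j => by
        have := htp j
        simp only [hnear, sub_self, norm_zero, min_self]
        positivity)
      (fun j k h => by
        simp only [hnear] at h ⊢
        rwa [norm_sub_rev, min_comm])
      M (fun j K hK => hk_count hL hδ (by linarith) (by linarith) z hz hsep K (z j) (hz j) R
        (by linarith) hK) J
    have h1 := hk_comb1 F s hF0 hc' hp.1 S (fun S' hS' hne => hop' S' hne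
      (fun j hj => hJ j (hSJ (hS' hj)))
      (fun j hj k hk hjk => (not_le.1 (hSn j (hS' hj) k (hS' hk) hjk)).le))
    have h2 : ∑ ν ∈ Finset.range S.card, s ν ^ p ≤ ∑' ν, s ν ^ p :=
      hsum.sum_le_tsum _ (fun ν _ => Real.rpow_nonneg (hs0 ν) _)
    refine hle.trans ?_
    rw [hB]
    refine mul_le_mul_of_nonneg_left (h1.trans ?_) hM0
    refine mul_le_mul_of_nonneg_left h2 (by positivity)
  have hfin := hk_inner_finite hW hL hδ (by linarith) (by linarith) z hz hsep hr1
  set I := hfin.toFinset with hI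
  have hfinal : ∑' j : ℕ, (FdeltaSqE t δ g (z j)) ^ (p / 2) ≤
      ENNReal.ofReal (∑ j ∈ I, W j + B) := by
    rw [ENNReal.tsum_eq_iSup_sum]
    refine iSup_le fun J => ?_
    simp only [hEq]
    rw [← ENNReal.ofReal_sum_of_nonneg fun j _ => hW0 j]
    apply ENNReal.ofReal_le_ofReal
    rw [← Finset.sum_filter_add_sum_filter_not J (fun j => j ∈ I)]
    refine add_le_add ?_ (hbound _ ?_)
    · exact Finset.sum_le_sum_of_subset_of_nonneg
        (fun j hj => (Finset.mem_filter.1 hj).2) (fun j _ _ => hW0 j)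
    · intro j hj
      have h := (Finset.mem_filter.1 hj).2
      rw [hI, Set.Finite.mem_toFinset] at h
      exact not_lt.1 h
  exact hfinal.trans_lt ENNReal.ofReal_lt_top

end
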